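/- Franel's theorem: the Riemann Hypothesis holds if and only if for every ε > 0 one has ∑_{ν=1}^{A(n)} |f_ν(n) - ν/A(n)| = O(n^{1/2 + ε}) as n → ∞, where f_1(n) < f_2(n) < … < f_{A(n)}(n) is the increasing enumeration of the reduced fractions in (0, 1] with denominator at most n and A(n) is their number; that is, RH is equivalent to the assertion that the elements of the Farey sequences are asymptotically evenly distributed in this quantitative sense. -/

import Mathlib

open Filter

/-- The Farey fractions of order `n` lying in `(0, 1]`, listed in increasing
order: all rationals `p/q` in `(0, 1]` whose reduced denominator is at most
`n` (every such fraction arises as `p/q` with `0 ≤ p, q ≤ n`). -/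
def fareyList (n : ℕ) : List ℚ :=
  (((Finset.range (n + 1) ×ˢ Finset.range (n + 1)).image
      (fun p : ℕ × ℕ => (p.1 : ℚ) / (p.2 : ℚ))).filter
    (fun q => 0 < q ∧ q ≤ 1)).sort (· ≤ ·)

namespace FranelAux

/-- Mertens function. -/
noncomputable def mert (n : ℕ) : ℝ := ∑ k ∈ Finset.Icc 1 n, ((ArithmeticFunction.moebius k : ℤ) : ℝ)

/-- The set underlying the Farey list. -/
def fareySet (n : ℕ) : Finset ℚ :=
  ((Finset.range (n + 1) ×ˢ Finset.range (n + 1)).image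
      (fun p : ℕ × ℕ => (p.1 : ℚ) / (p.2 : ℚ))).filter
    (fun q => 0 < q ∧ q ≤ 1)

lemma den_div_dvd (a b : ℕ) : ((a : ℚ) / (b : ℚ)).den ∣ b := by
  have := Rat.den_dvd (a : ℤ) (b : ℤ)
  rw [Rat.divInt_eq_div, Int.natCast_dvd_natCast] at this
  simpa using this

lemma mem_fareySet {n : ℕ} {q : ℚ} : q ∈ fareySet n ↔ 0 < q ∧ q ≤ 1 ∧ q.den ≤ n := by
  unfold fareySet
  simp only [Finset.mem_filter, Finset.mem_image, Finset.mem_product, Finset.mem_range, Prod.exists]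
  constructor
  · rintro ⟨⟨a, b, ⟨ha, hb⟩, rfl⟩, h0, h1⟩
    refine ⟨h0, h1, ?_⟩
    have hb0 : b ≠ 0 := by rintro rfl; simp at h0
    have : ((a : ℚ) / (b : ℚ)).den ∣ b := by
      exact den_div_dvd a b
    have := Nat.le_of_dvd (Nat.pos_of_ne_zero hb0) this
    omega
  · rintro ⟨h0, h1, h2⟩
    refine ⟨⟨q.num.toNat, q.den, ⟨?_, by omega⟩, ?_⟩, h0, h1⟩
    · have : q.num ≤ q.den := by
        have := Rat.num_div_den q
        rw [← this, div_le_one (by exact_mod_cast q.den_pos)] at h1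
        exact_mod_cast h1
      omega
    · have : ((q.num.toNat : ℤ)) = q.num := Int.toNat_of_nonneg (Rat.num_nonneg.mpr h0.le)
      have h3 : ((q.num.toNat : ℕ) : ℚ) = (q.num : ℚ) := by exact_mod_cast congrArg (Int.cast : ℤ → ℚ) this
      rw [h3, Rat.num_div_den]

/-- fractions j/k, 1≤j≤k are the q in (0,1] with den ∣ k -/
lemma sum_div_eq (k n : ℕ) (hk : 1 ≤ k) (hkn : k ≤ n) (h : ℚ → ℂ) :
    ∑ j ∈ Finset.Icc 1 k, h ((j : ℚ) / k) = ∑ f ∈ fareySet n, if f.den ∣ k then h f else 0 := by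
  rw [← Finset.sum_filter]
  have hk0 : (0 : ℚ) < k := by exact_mod_cast hk
  refine Finset.sum_bij (fun j _ => (j : ℚ) / k) ?_ ?_ ?_ ?_
  · intro j hj
    rw [Finset.mem_Icc] at hj
    have hd : ((j : ℚ) / (k : ℚ)).den ∣ k := by
      exact den_div_dvd j k
    rw [Finset.mem_filter, mem_fareySet]
    refine ⟨⟨?_, ?_, (Nat.le_of_dvd hk hd).trans hkn⟩, hd⟩
    · have : (0 : ℚ) < j := by exact_mod_cast hj.1
      positivity
    · rw [div_le_one hk0]; exact_mod_cast hj.2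
  · intro a _ b _ hab
    field_simp at hab
    exact_mod_cast hab
  · intro q hq
    rw [Finset.mem_filter, mem_fareySet] at hq
    obtain ⟨⟨h0, h1, h2⟩, e, he⟩ := hq
    have hn : ((q.num.toNat : ℤ)) = q.num := Int.toNat_of_nonneg (Rat.num_nonneg.mpr h0.le)
    have h3 : ((q.num.toNat : ℕ) : ℚ) = (q.num : ℚ) := by exact_mod_cast congrArg (Int.cast : ℤ → ℚ) hn
    have he0 : (e : ℚ) ≠ 0 := by
      rintro h; have : e = 0 := by exact_mod_cast h
      subst this; omega
    have hq0 : (q.den : ℚ) ≠ 0 := by exact_mod_cast q.den_ne_zero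
    have key : ((q.num.toNat * e : ℕ) : ℚ) / k = q := by
      rw [he]; push_cast; rw [h3]
      nth_rewrite 3 [← Rat.num_div_den q]
      field_simp
    refine ⟨q.num.toNat * e, ?_, key⟩
    rw [Finset.mem_Icc]
    have e1 : ((q.num.toNat * e : ℕ) : ℚ) = q * k := (div_eq_iff hk0.ne').mp key
    constructor
    · have : (0 : ℚ) < ((q.num.toNat * e : ℕ) : ℚ) := by rw [e1]; positivity
      have : 0 < q.num.toNat * e := by exact_mod_cast this
      omega
    · have : ((q.num.toNat * e : ℕ) : ℚ) ≤ k := by rw [e1]; nlinarith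
      exact_mod_cast this
  · intro j _; rfl

lemma mert_eq (n k : ℕ) (hk : 1 ≤ k) : mert (n / k) = ∑ e ∈ Finset.Icc 1 n, 
    if e * k ≤ n then ((ArithmeticFunction.moebius e : ℤ) : ℝ) else 0 := by
  unfold mert
  rw [← Finset.sum_filter]
  apply Finset.sum_congr _ (fun _ _ => rfl)
  ext e
  simp only [Finset.mem_Icc, Finset.mem_filter, Nat.le_div_iff_mul_le hk]
  constructor
  · rintro ⟨h1, h2⟩; exact ⟨⟨h1, (Nat.le_mul_of_pos_right e hk).trans h2⟩, h2⟩
  · rintro ⟨⟨h1, _⟩, h2⟩; exact ⟨h1, h2⟩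

lemma sum_moebius_dvd (m : ℕ) (hm : 1 ≤ m) :
    ∑ e ∈ m.divisors, ((ArithmeticFunction.moebius e : ℤ) : ℝ) = if m = 1 then 1 else 0 := by
  have h := congrArg (fun f => f m) ArithmeticFunction.coe_zeta_mul_moebius
  simp only [ArithmeticFunction.coe_zeta_mul_apply, ArithmeticFunction.one_apply] at h
  exact_mod_cast congrArg (Int.cast : ℤ → ℝ) h

lemma sum_mert_div (m : ℕ) (hm : 1 ≤ m) : ∑ j ∈ Finset.Icc 1 m, mert (m / j) = 1 := by
  have h1 : ∀ j ∈ Finset.Icc 1 m, mert (m / j) = ∑ e ∈ Finset.Icc 1 m, ∑ t ∈ Finset.Icc 1 m, 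
      if e * j = t then ((ArithmeticFunction.moebius e : ℤ) : ℝ) else 0 := by
    intro j hj
    rw [Finset.mem_Icc] at hj
    rw [mert_eq m j hj.1]
    apply Finset.sum_congr rfl
    intro e he
    rw [Finset.mem_Icc] at he
    rw [Finset.sum_ite_eq]
    have : 1 ≤ e * j := Nat.mul_pos he.1 hj.1
    simp [this]
  rw [Finset.sum_congr rfl h1, Finset.sum_comm' (t' := Finset.Icc 1 m) (s' := fun _ => Finset.Icc 1 m) (by simp [and_comm])]
  have h2 : ∀ e ∈ Finset.Icc 1 m, ∑ j ∈ Finset.Icc 1 m, ∑ t ∈ Finset.Icc 1 m, 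
      (if e * j = t then ((ArithmeticFunction.moebius e : ℤ) : ℝ) else 0)
      = ∑ t ∈ Finset.Icc 1 m, if e ∣ t then ((ArithmeticFunction.moebius e : ℤ) : ℝ) else 0 := by
    intro e he
    rw [Finset.mem_Icc] at he
    rw [Finset.sum_comm]
    apply Finset.sum_congr rfl
    intro t ht
    rw [Finset.mem_Icc] at ht
    split_ifs with hd
    · obtain ⟨c, rfl⟩ := hd
      rw [Finset.sum_eq_single c]
      · simp
      · intro b _ hb
        rw [if_neg]; intro h; exact hb (Nat.eq_of_mul_eq_mul_left he.1 h)
      · intro hc; exfalso; apply hc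
        rw [Finset.mem_Icc]
        constructor
        · rcases Nat.eq_zero_or_pos c with rfl | h
          · simp at ht
          · exact h
        · exact (Nat.le_mul_of_pos_left c he.1).trans ht.2
    · apply Finset.sum_eq_zero
      intro j _
      rw [if_neg]; rintro rfl; exact hd (dvd_mul_right _ _)
  rw [Finset.sum_congr rfl h2, Finset.sum_comm]
  have h3 : ∀ t ∈ Finset.Icc 1 m, ∑ e ∈ Finset.Icc 1 m, (if e ∣ t then ((ArithmeticFunction.moebius e : ℤ) : ℝ) else 0) = if t = 1 then 1 else 0 := by
    intro t ht
    rw [Finset.mem_Icc] at ht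
    rw [← sum_moebius_dvd t ht.1, ← Finset.sum_filter]
    apply Finset.sum_congr _ (fun _ _ => rfl)
    ext e
    simp only [Finset.mem_filter, Finset.mem_Icc, Nat.mem_divisors]
    constructor
    · rintro ⟨_, h⟩; exact ⟨h, by omega⟩
    · rintro ⟨h, _⟩; exact ⟨⟨Nat.pos_of_dvd_of_pos h ht.1, (Nat.le_of_dvd ht.1 h).trans ht.2⟩, h⟩
  rw [Finset.sum_congr rfl h3, Finset.sum_ite_eq']
  simp [hm]

lemma farey_sum (n : ℕ) (h : ℚ → ℂ) :
    ∑ f ∈ fareySet n, h f = ∑ k ∈ Finset.Icc 1 n, (mert (n / k) : ℂ) * ∑ j ∈ Finset.Icc 1 k, h ((j : ℚ) / k) := by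
  have h1 : ∀ k ∈ Finset.Icc 1 n, (mert (n / k) : ℂ) * ∑ j ∈ Finset.Icc 1 k, h ((j : ℚ) / k)
     = ∑ f ∈ fareySet n, if f.den ∣ k then (mert (n / k) : ℂ) * h f else 0 := by
    intro k hk
    rw [Finset.mem_Icc] at hk
    rw [sum_div_eq k n hk.1 hk.2, Finset.mul_sum]
    simp
  rw [Finset.sum_congr rfl h1, Finset.sum_comm]
  apply Finset.sum_congr rfl
  intro f hf
  rw [mem_fareySet] at hf
  have hd := f.den_pos
  rw [← Finset.sum_filter, ← Finset.sum_mul]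
  have : ∑ k ∈ Finset.Icc 1 n with f.den ∣ k, (mert (n / k) : ℂ) = ∑ j ∈ Finset.Icc 1 (n / f.den), (mert ((n / f.den) / j) : ℂ) := by
    symm
    refine Finset.sum_bij (fun j _ => f.den * j) ?_ ?_ ?_ ?_
    · intro j hj
      rw [Finset.mem_Icc, Nat.le_div_iff_mul_le hd] at hj
      rw [Finset.mem_filter, Finset.mem_Icc]
      exact ⟨⟨Nat.mul_pos hd hj.1, by rw [mul_comm]; exact hj.2⟩, dvd_mul_right _ _⟩
    · intro a _ b _ hab; exact Nat.eq_of_mul_eq_mul_left hd hab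
    · intro k hk
      rw [Finset.mem_filter, Finset.mem_Icc] at hk
      obtain ⟨⟨h1, h2⟩, c, rfl⟩ := hk
      refine ⟨c, ?_, rfl⟩
      rw [Finset.mem_Icc, Nat.le_div_iff_mul_le hd]
      exact ⟨Nat.pos_of_mul_pos_left h1, by rw [mul_comm]; exact h2⟩
    · intro j _; rw [Nat.div_div_eq_div_mul]
  rw [this]
  have h2 := sum_mert_div (n / f.den) ((Nat.one_le_div_iff hd).mpr hf.2.2)
  have h3 : ∑ j ∈ Finset.Icc 1 (n / f.den), (mert ((n / f.den) / j) : ℂ) = 1 := by exact_mod_cast h2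
  rw [h3, one_mul]

end FranelAux

namespace FranelAux
open MeasureTheory

lemma fareyList_eq (n : ℕ) : fareyList n = (fareySet n).sort (· ≤ ·) := rfl

lemma fareyList_length (n : ℕ) : (fareyList n).length = (fareySet n).card := by
  rw [fareyList_eq, Finset.length_sort]

lemma sum_fareyList {E : Type*} [AddCommMonoid E] (n : ℕ) (h : ℚ → E) :
    ∑ ν ∈ Finset.range (fareyList n).length, h ((fareyList n).getD ν 0) = ∑ f ∈ fareySet n, h f := by
  have h1 : (fareyList n).toFinset = fareySet n := by rw [fareyList_eq, Finset.sort_toFinset]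
  have h2 : (fareyList n).Nodup := by rw [fareyList_eq]; exact Finset.sort_nodup _ _
  rw [← h1, List.sum_toFinset h h2, Finset.sum_range, ← Fin.sum_univ_getElem]
  refine Fintype.sum_equiv (finCongr (by simp)) _ _ ?_
  intro i
  simp

lemma fareyList_mem (n ν : ℕ) (hν : ν < (fareyList n).length) : (fareyList n).getD ν 0 ∈ fareySet n := by
  rw [List.getD_eq_getElem _ _ hν]
  exact (Finset.mem_sort (· ≤ ·)).mp (List.getElem_mem hν)

lemma fareyList_mono (n μ ν : ℕ) (hμ : μ < ν) (hν : ν < (fareyList n).length) :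
    (fareyList n).getD μ 0 ≤ (fareyList n).getD ν 0 := by
  rw [List.getD_eq_getElem _ _ hν, List.getD_eq_getElem _ _ (hμ.trans hν)]
  have h : (fareyList n).Pairwise (· ≤ ·) := by
    rw [fareyList_eq]; exact Finset.pairwise_sort _ _
  exact List.pairwise_iff_getElem.mp h _ _ (hμ.trans hν) hν hμ

lemma sum_shift {E : Type*} [AddCommMonoid E] (k : ℕ) (F : ℕ → E) :
    ∑ j ∈ Finset.Icc 1 k, F j = ∑ j ∈ Finset.range k, F (j + 1) := by
  rw [Finset.range_eq_Ico, Finset.sum_Ico_add' F 0 k 1]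
  apply Finset.sum_congr _ fun _ _ => rfl
  ext j; simp

/-- step function -/
noncomputable def stp (c x : ℝ) : ℝ := if c ≤ x then 1 else 0

lemma stp_eq (c : ℝ) : stp c = Set.indicator (Set.Ici c) 1 := by
  ext x; simp [stp, Set.indicator_apply]

lemma stp_meas (c : ℝ) : Measurable (stp c) := by
  rw [stp_eq]; exact measurable_one.indicator measurableSet_Ici

lemma ii_of_bdd (f : ℝ → ℝ) (hf : Measurable f) (C : ℝ) (hC : ∀ x, |f x| ≤ C) (a b : ℝ) :
    IntervalIntegrable f volume a b := by
  refine (intervalIntegrable_const (c := C)).mono_fun hf.aestronglyMeasurable ?_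
  refine Eventually.of_forall fun x => ?_
  exact (hC x).trans (le_abs_self C)

lemma stp_bd (c x : ℝ) : 0 ≤ stp c x ∧ stp c x ≤ 1 := by unfold stp; split_ifs <;> norm_num

lemma stp_ii (c a b : ℝ) : IntervalIntegrable (stp c) volume a b :=
  ii_of_bdd _ (stp_meas c) 1 (fun x => by rw [abs_le]; have := stp_bd c x; constructor <;> linarith) a b

lemma stp_int (c : ℝ) (h0 : 0 ≤ c) (h1 : c ≤ 1) : ∫ x in (0:ℝ)..1, stp c x = 1 - c := by
  rw [← intervalIntegral.integral_add_adjacent_intervals (stp_ii c 0 c) (stp_ii c c 1)]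
  have e1 : ∫ x in (0:ℝ)..c, stp c x = ∫ x in (0:ℝ)..c, 0 := by
    apply intervalIntegral.integral_congr_ae
    have : ∀ᵐ x : ℝ, x ≠ c := by simp [ae_iff, measure_singleton]
    filter_upwards [this] with x hx hm
    rw [Set.uIoc_of_le h0] at hm
    have : ¬ c ≤ x := not_le.mpr (lt_of_le_of_ne hm.2 hx)
    simp [stp, this]
  have e2 : ∫ x in c..1, stp c x = ∫ x in c..1, 1 := by
    apply intervalIntegral.integral_congr
    intro x hx
    rw [Set.uIcc_of_le h1] at hx
    simp [stp, hx.1]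
  rw [e1, e2]; simp

lemma abs_sub_le_int (c d : ℝ) (hc0 : 0 ≤ c) (hc1 : c ≤ 1) (hd0 : 0 ≤ d) (hd1 : d ≤ 1) :
    |c - d| ≤ ∫ x in (0:ℝ)..1, |stp c x - stp d x| := by
  have h : ∫ x in (0:ℝ)..1, (stp c x - stp d x) = d - c := by
    rw [intervalIntegral.integral_sub (stp_ii _ _ _) (stp_ii _ _ _), stp_int c hc0 hc1, stp_int d hd0 hd1]
    ring
  rw [abs_sub_comm, ← h]
  exact intervalIntegral.abs_integral_le_integral_abs (by norm_num)

lemma sum_abs_stp (A : ℕ) (f g : ℕ → ℝ) (hf : ∀ μ ν, μ < ν → ν < A → f μ ≤ f ν)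
    (hg : ∀ μ ν, μ < ν → ν < A → g μ ≤ g ν) (x : ℝ) :
    ∑ ν ∈ Finset.range A, |stp (f ν) x - stp (g ν) x| = 
      |∑ ν ∈ Finset.range A, stp (f ν) x - ∑ ν ∈ Finset.range A, stp (g ν) x| := by
  rw [← Finset.sum_sub_distrib]
  by_cases H : ∀ ν ∈ Finset.range A, 0 ≤ stp (f ν) x - stp (g ν) x
  · rw [abs_of_nonneg (Finset.sum_nonneg H)]
    exact Finset.sum_congr rfl fun ν hν => abs_of_nonneg (H ν hν)
  · push Not at H
    obtain ⟨ν, hν, h⟩ := H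
    have h1 : x < f ν ∧ g ν ≤ x := by
      unfold stp at h; split_ifs at h <;> norm_num at h <;> constructor <;> linarith
    have H' : ∀ μ ∈ Finset.range A, stp (f μ) x - stp (g μ) x ≤ 0 := by
      intro μ hμ
      by_contra hc
      push Not at hc
      have h2 : f μ ≤ x ∧ x < g μ := by
        unfold stp at hc; split_ifs at hc <;> norm_num at hc <;> constructor <;> linarith
      rw [Finset.mem_range] at hμ hν
      rcases lt_trichotomy μ ν with hl | rfl | hl
      · have := hg μ ν hl hν; linarith
      · linarith
      · have := hf ν μ hl hμ; linarith
    rw [abs_of_nonpos (Finset.sum_nonpos H'), ← Finset.sum_neg_distrib]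
    exact Finset.sum_congr rfl fun ν hν => abs_of_nonpos (H' ν hν)

lemma sum_stp_grid (A : ℕ) (hA : 0 < A) (x : ℝ) (hx0 : 0 ≤ x) (hx1 : x < 1) :
    ∑ ν ∈ Finset.range A, stp (((ν : ℝ) + 1) / A) x = (⌊(A : ℝ) * x⌋₊ : ℝ) := by
  have hA' : (0:ℝ) < A := by exact_mod_cast hA
  have hAx : (A:ℝ) * x < A := by nlinarith
  have hfl : ⌊(A : ℝ) * x⌋₊ < A := (Nat.floor_lt (by positivity)).mpr hAx
  unfold stp
  rw [← Finset.sum_filter, Finset.sum_const, nsmul_eq_mul, mul_one]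
  congr 1
  have : (Finset.range A).filter (fun ν : ℕ => ((ν : ℝ) + 1) / A ≤ x) = Finset.range ⌊(A : ℝ) * x⌋₊ := by
    ext ν
    rw [Finset.mem_filter, Finset.mem_range, Finset.mem_range, div_le_iff₀ hA', mul_comm x,
      ← Nat.succ_le_iff (m := ν) (n := ⌊(A : ℝ) * x⌋₊), Nat.le_floor_iff (by positivity)]
    push_cast
    constructor
    · rintro ⟨_, h⟩; exact h
    · intro h; refine ⟨?_, h⟩
      have : (ν : ℝ) < A := by linarith
      exact_mod_cast this
  rw [this, Finset.card_range]

lemma farey_count (n : ℕ) (x : ℝ) (hx0 : 0 ≤ x) (hx1 : x < 1) :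
    ∑ f ∈ fareySet n, stp (f : ℝ) x = ∑ k ∈ Finset.Icc 1 n, mert (n / k) * (⌊(k : ℝ) * x⌋₊ : ℝ) := by
  have h := farey_sum n (fun q => ((stp (q : ℝ) x : ℝ) : ℂ))
  have h' : ∑ f ∈ fareySet n, stp (f : ℝ) x = ∑ k ∈ Finset.Icc 1 n, mert (n / k) * ∑ j ∈ Finset.Icc 1 k, stp (((j : ℚ) / k : ℚ) : ℝ) x := by
    exact_mod_cast h
  rw [h']
  refine Finset.sum_congr rfl fun k hk => ?_
  rw [Finset.mem_Icc] at hk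
  rw [← sum_stp_grid k hk.1 x hx0 hx1]
  congr 1
  rw [sum_shift]
  push_cast
  rfl

lemma farey_card (n : ℕ) : ((fareySet n).card : ℝ) = ∑ k ∈ Finset.Icc 1 n, mert (n / k) * (k : ℝ) := by
  have h := farey_sum n (fun q => 1)
  simp at h
  exact_mod_cast h

/-- sawtooth -/
noncomputable def saw (y : ℝ) : ℝ := Int.fract y - 1 / 2

lemma farey_disc (n : ℕ) (hn : 1 ≤ n) (x : ℝ) (hx0 : 0 ≤ x) (hx1 : x < 1) :
    ∑ f ∈ fareySet n, stp (f : ℝ) x - (fareySet n).card * x = 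
      - (∑ k ∈ Finset.Icc 1 n, mert (n / k) * saw (k * x)) - 1 / 2 := by
  have h1 := sum_mert_div n hn
  have : (1:ℝ)/2 = ∑ k ∈ Finset.Icc 1 n, mert (n / k) * (1/2) := by rw [← Finset.sum_mul, h1]; ring
  rw [farey_count n x hx0 hx1, farey_card, this, Finset.sum_mul, ← Finset.sum_sub_distrib, ← Finset.sum_neg_distrib,
    ← Finset.sum_sub_distrib]
  refine Finset.sum_congr rfl fun k _ => ?_
  unfold saw
  rw [natCast_floor_eq_intCast_floor (by positivity), ← Int.self_sub_floor]
  ring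

lemma saw_meas (a : ℝ) : Measurable (fun x => saw (a * x)) := by
  unfold saw
  exact (measurable_fract.comp (measurable_const.mul measurable_id)).sub_const _

lemma saw_bd (x : ℝ) : |saw x| ≤ 1 := by
  unfold saw; rw [abs_le]
  have := Int.fract_nonneg x; have := Int.fract_lt_one x
  constructor <;> linarith

/-- the error function -/
noncomputable def err (n : ℕ) (x : ℝ) : ℝ := ∑ k ∈ Finset.Icc 1 n, mert (n / k) * saw (k * x)

lemma err_meas (n : ℕ) : Measurable (err n) := by
  unfold err
  exact Finset.measurable_fun_sum _ fun k _ => (saw_meas k).const_mul _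

lemma err_bd (n : ℕ) (x : ℝ) : |err n x| ≤ ∑ k ∈ Finset.Icc 1 n, |mert (n / k)| := by
  unfold err
  refine (Finset.abs_sum_le_sum_abs _ _).trans (Finset.sum_le_sum fun k _ => ?_)
  rw [abs_mul]
  exact mul_le_of_le_one_right (abs_nonneg _) (saw_bd _)

lemma card_pos (n : ℕ) (hn : 1 ≤ n) : 0 < (fareySet n).card := by
  rw [Finset.card_pos]
  exact ⟨1, by rw [mem_fareySet]; simpa using hn⟩

theorem farey_L1 (n : ℕ) (hn : 1 ≤ n) :
    ∑ ν ∈ Finset.range (fareyList n).length,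
            |(((fareyList n).getD ν 0 : ℚ) : ℝ) -
              ((ν : ℝ) + 1) / ((fareyList n).length : ℝ)| ≤ (∫ x in (0:ℝ)..1, |err n x|) + 3/2 := by
  set A := (fareyList n).length with hA
  have hA1 : A = (fareySet n).card := fareyList_length n
  have hA0 : 0 < A := by rw [hA1]; exact card_pos n hn
  have hA' : (0:ℝ) < A := by exact_mod_cast hA0
  have b1 : ∀ ν ∈ Finset.range A, |(((fareyList n).getD ν 0 : ℚ) : ℝ) - ((ν : ℝ) + 1) / (A : ℝ)|
      ≤ ∫ x in (0:ℝ)..1, |stp (((fareyList n).getD ν 0 : ℚ) : ℝ) x - stp (((ν : ℝ) + 1) / (A : ℝ)) x| := by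
    intro ν hν
    rw [Finset.mem_range] at hν
    have hm := mem_fareySet.mp (fareyList_mem n ν hν)
    apply abs_sub_le_int
    · exact_mod_cast hm.1.le
    · exact_mod_cast hm.2.1
    · positivity
    · rw [div_le_one hA']; exact_mod_cast hν
  refine (Finset.sum_le_sum b1).trans ?_
  have ii : ∀ ν : ℕ, IntervalIntegrable (fun x => |stp (((fareyList n).getD ν 0 : ℚ) : ℝ) x - stp (((ν : ℝ) + 1) / (A : ℝ)) x|) volume 0 1 :=
    fun ν => ((stp_ii _ _ _).sub (stp_ii _ _ _)).abs
  have ie : IntervalIntegrable (fun x => |err n x|) volume 0 1 :=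
    (ii_of_bdd _ (err_meas n) _ (err_bd n) 0 1).abs
  rw [← intervalIntegral.integral_finsetSum (fun ν _ => ii ν)]
  have e : (∫ x in (0:ℝ)..1, |err n x|) + 3/2 = ∫ x in (0:ℝ)..1, (|err n x| + 3/2) := by
    rw [intervalIntegral.integral_add ie (by simp)]; simp
  rw [e]
  apply intervalIntegral.integral_mono_on_of_le_Ioo (by norm_num)
  · have := IntervalIntegrable.sum (Finset.range A) (fun ν _ => ii ν)
    convert! this using 1
    ext x; simp
  · exact ie.add (by simp)
  intro x hx
  rw [sum_abs_stp A (fun ν => (((fareyList n).getD ν 0 : ℚ) : ℝ)) (fun ν => ((ν : ℝ) + 1) / (A : ℝ))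
    (fun μ ν h1 h2 => by exact_mod_cast fareyList_mono n μ ν h1 h2)
    (fun μ ν h1 h2 => by have : (μ : ℝ) ≤ ν := by exact_mod_cast h1.le
                         gcongr)]
  rw [sum_stp_grid A hA0 x hx.1.le hx.2, sum_fareyList n (fun q => stp (q : ℝ) x)]
  have hd := farey_disc n hn x hx.1.le hx.2
  rw [← hA1] at hd
  have f1 := Nat.floor_le (show 0 ≤ (A : ℝ) * x by have := hx.1; positivity)
  have f2 := Nat.lt_floor_add_one ((A : ℝ) * x)
  change _ = - err n x - 1 / 2 at hd
  rw [abs_le]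
  have := neg_abs_le (err n x)
  have := le_abs_self (err n x)
  constructor <;> linarith

theorem farey_exp (n : ℕ) (hn : 2 ≤ n) :
    |mert n| ≤ 2 * Real.pi * ∑ ν ∈ Finset.range (fareyList n).length,
            |(((fareyList n).getD ν 0 : ℚ) : ℝ) -
              ((ν : ℝ) + 1) / ((fareyList n).length : ℝ)| := by
  set A := (fareyList n).length with hA
  have hA1 : A = (fareySet n).card := fareyList_length n
  let e : ℝ → ℂ := fun x => Complex.exp ((2 * Real.pi * x : ℝ) * Complex.I)
  have grid : ∀ k : ℕ, 1 ≤ k → ∑ j ∈ Finset.range k, e (((j : ℝ) + 1) / k) = if k = 1 then 1 else 0 := by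
    intro k hk
    have hk0 : (k : ℂ) ≠ 0 := by exact_mod_cast (by omega : k ≠ 0)
    split_ifs with h
    · subst h
      simp [e, Complex.exp_two_pi_mul_I]
    · have hp := Complex.isPrimitiveRoot_exp k (by omega)
      have hs := hp.geom_sum_eq_zero (by omega)
      have : ∀ j ∈ Finset.range k, e (((j : ℝ) + 1) / k) = Complex.exp (2 * Real.pi * Complex.I / k) * Complex.exp (2 * Real.pi * Complex.I / k) ^ j := by
        intro j _
        rw [← pow_succ', ← Complex.exp_nat_mul]
        simp only [e]
        congr 1
        push_cast
        field_simp
      rw [Finset.sum_congr rfl this, ← Finset.mul_sum, hs, mul_zero]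
  have s1 : ∑ ν ∈ Finset.range A, e (((fareyList n).getD ν 0 : ℚ) : ℝ) = (mert n : ℂ) := by
    rw [sum_fareyList n (fun q => e (q : ℝ)), farey_sum]
    rw [Finset.sum_eq_single 1]
    · have := grid 1 le_rfl
      simp at this ⊢
      rw [this]; simp
    · intro k hk hk1
      rw [Finset.mem_Icc] at hk
      have := grid k hk.1
      rw [if_neg hk1] at this
      have h2 : ∑ j ∈ Finset.Icc 1 k, e (((j : ℚ) / k : ℚ) : ℝ) = 0 := by
        rw [← this, sum_shift]; push_cast; rfl
      rw [h2, mul_zero]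
    · intro h; exfalso; apply h; simp; omega
  have hA2 : 2 ≤ A := by
    rw [hA1]
    have : ({1, 1/2} : Finset ℚ) ⊆ fareySet n := by
      intro q hq
      simp at hq
      rw [mem_fareySet]
      rcases hq with rfl | rfl
      · simp; omega
      · have : (2:ℚ)⁻¹.den = 2 := by norm_num
        rw [this]; norm_num; omega
    have := Finset.card_le_card this
    rwa [Finset.card_pair (by norm_num)] at this
  have s2 := grid A (by omega)
  rw [if_neg (by omega)] at s2
  have lip : ∀ x y : ℝ, ‖e x - e y‖ ≤ 2 * Real.pi * |x - y| := by
    intro x y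
    have h0 : e x - e y = Complex.exp ((2 * Real.pi * y : ℝ) * Complex.I) * (Complex.exp (Complex.I * (2 * Real.pi * (x - y) : ℝ)) - 1) := by
      rw [mul_sub, ← Complex.exp_add]; simp only [e]; push_cast; ring_nf
    rw [h0, norm_mul, Complex.norm_exp_ofReal_mul_I, one_mul]
    refine (Real.norm_exp_I_mul_ofReal_sub_one_le).trans ?_
    rw [Real.norm_eq_abs, abs_mul, abs_of_pos Real.two_pi_pos]
  have : |mert n| = ‖∑ ν ∈ Finset.range A, (e (((fareyList n).getD ν 0 : ℚ) : ℝ) - e (((ν : ℝ) + 1) / A))‖ := by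
    rw [Finset.sum_sub_distrib, s1, s2, sub_zero, Complex.norm_real, Real.norm_eq_abs]
  rw [this, Finset.mul_sum]
  exact (norm_sum_le _ _).trans (Finset.sum_le_sum fun ν _ => lip _ _)

end FranelAux

namespace FranelAux
open MeasureTheory

lemma fract_aux (b : ℕ) (hb : 0 < b) (y : ℝ) (c : ℤ) :
    Int.fract (y + c / b) = ((((⌊(b:ℝ) * y⌋ + c) % b : ℤ) : ℝ) + Int.fract ((b:ℝ) * y)) / b := by
  have hb' : (0:ℝ) < b := by exact_mod_cast hb
  have hbz : (0:ℤ) < b := by exact_mod_cast hb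
  rw [Int.fract_eq_iff]
  set t : ℤ := ⌊(b:ℝ) * y⌋ + c with ht
  have h1 : 0 ≤ t % b := Int.emod_nonneg _ hbz.ne'
  have h2 : t % b + 1 ≤ b := Int.emod_lt_of_pos _ hbz
  have h1' : (0:ℝ) ≤ ((t % b : ℤ) : ℝ) := by exact_mod_cast h1
  have h2' : ((t % b : ℤ) : ℝ) + 1 ≤ b := by exact_mod_cast h2
  have f1 := Int.fract_nonneg ((b:ℝ) * y)
  have f2 := Int.fract_lt_one ((b:ℝ) * y)
  refine ⟨by positivity, by rw [div_lt_one hb']; linarith, t / b, ?_⟩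
  have h3 : ((t % b : ℤ) : ℝ) = t - b * ((t / b : ℤ) : ℝ) := by
    have := Int.emod_add_mul_ediv t b
    have : t % b = t - b * (t / b) := by linarith
    rw [this]; push_cast; ring
  have h4 : (t : ℝ) = (b:ℝ) * y - Int.fract ((b:ℝ) * y) + c := by
    rw [ht, Int.self_sub_fract]; push_cast; ring
  rw [h3, h4]
  field_simp
  ring

lemma sum_emod (a b : ℕ) (hb : 0 < b) (hab : Nat.Coprime a b) (m : ℤ) :
    ∑ j ∈ Finset.range b, (((m + a * j) % b : ℤ) : ℝ) = (b : ℝ) * (b - 1) / 2 := by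
  have hbz : (0:ℤ) < b := by exact_mod_cast hb
  have inj : Set.InjOn (fun j : ℕ => ((m + a * j) % b : ℤ).toNat) (Finset.range b : Set ℕ) := by
    intro i hi j hj hij
    simp only [Finset.coe_range, Set.mem_Iio] at hi hj
    have e1 := Int.emod_nonneg (m + a * i) hbz.ne'
    have e2 := Int.emod_nonneg (m + a * j) hbz.ne'
    have h : (m + a * i) % b = (m + a * j) % b := by simp only at hij; omega
    have h1 : (b : ℤ) ∣ a * (i - j) := by
      have := Int.emod_emod_of_dvd
      have := (Int.emod_emod_of_dvd (m + a * i) (dvd_refl (b:ℤ)))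
      have h2 : (m + a * i) ≡ (m + a * j) [ZMOD b] := h
      have := h2.symm.dvd
      convert! this using 1; ring
    have h3 : (b : ℤ) ∣ (i - j) := by
      refine IsCoprime.dvd_of_dvd_mul_left ?_ h1
      exact (Nat.isCoprime_iff_coprime.mpr hab).symm
    have := Int.eq_zero_of_abs_lt_dvd h3 (by rw [abs_lt]; constructor <;> omega)
    omega
  have img : (Finset.range b).image (fun j : ℕ => ((m + a * j) % b : ℤ).toNat) = Finset.range b := by
    apply Finset.eq_of_subset_of_card_le
    · intro x hx
      rw [Finset.mem_image] at hx
      obtain ⟨j, _, rfl⟩ := hx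
      have e1 := Int.emod_nonneg (m + a * j) hbz.ne'
      have e2 := Int.emod_lt_of_pos (m + a * j) hbz
      rw [Finset.mem_range]; omega
    · rw [Finset.card_image_of_injOn inj]
  have h1 : ∑ j ∈ Finset.range b, (((m + a * j) % b : ℤ) : ℝ) = ∑ i ∈ Finset.range b, (i : ℝ) := by
    conv_rhs => rw [← img]
    rw [Finset.sum_image inj]
    refine Finset.sum_congr rfl fun j _ => ?_
    have e1 := Int.emod_nonneg (m + a * j) hbz.ne'
    have : ((((m + a * j) % b : ℤ).toNat : ℤ)) = (m + a * j) % b := Int.toNat_of_nonneg e1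
    exact_mod_cast congrArg (Int.cast : ℤ → ℝ) this.symm
  rw [h1]
  have : ∀ n : ℕ, ∑ i ∈ Finset.range n, (i : ℝ) = (n : ℝ) * (n - 1) / 2 := by
    intro n
    induction n with
    | zero => simp
    | succ k ih => rw [Finset.sum_range_succ, ih]; push_cast; ring
  exact this b

lemma saw_avg (a b : ℕ) (hb : 0 < b) (hab : Nat.Coprime a b) (y : ℝ) :
    ∑ j ∈ Finset.range b, saw (y + a * j / b) = saw (b * y) := by
  have hb' : (b:ℝ) ≠ 0 := by exact_mod_cast hb.ne'
  unfold saw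
  have : ∀ j ∈ Finset.range b, Int.fract (y + a * j / b) - 1 / 2 = 
     (((⌊(b:ℝ) * y⌋ + a * j) % b : ℤ) : ℝ) / b + (Int.fract ((b:ℝ) * y) / b - 1 / 2) := by
    intro j _
    have := fract_aux b hb y (a * j)
    push_cast at this ⊢
    rw [this]; ring
  rw [Finset.sum_congr rfl this, Finset.sum_add_distrib, ← Finset.sum_div, sum_emod a b hb hab]
  rw [Finset.sum_const, Finset.card_range, nsmul_eq_mul]
  field_simp
  ring

/-- correlation -/
noncomputable def cor (a b : ℕ) : ℝ := ∫ x in (0:ℝ)..1, saw (a * x) * saw (b * x)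

lemma saw_periodic : Function.Periodic saw 1 := by
  intro x; unfold saw; rw [Int.fract_add_one]

lemma saw_add_nat (x : ℝ) (n : ℕ) : saw (x + n) = saw x := by
  unfold saw; rw [Int.fract_add_natCast]

lemma ii_saw2 (a b : ℝ) (u v : ℝ) : IntervalIntegrable (fun x => saw (a * x) * saw (b * x)) volume u v := by
  apply ii_of_bdd _ ((saw_meas a).mul (saw_meas b)) 1
  intro x
  change |saw (a * x) * saw (b * x)| ≤ 1
  rw [abs_mul]
  exact mul_le_one₀ (saw_bd _) (abs_nonneg _) (saw_bd _)

lemma per_saw2 (a b : ℕ) : Function.Periodic (fun x : ℝ => saw (a * x) * saw (b * x)) 1 := by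
  intro x
  simp only [mul_add, mul_one, saw_add_nat]

lemma cor_scale (a b g : ℕ) (hg : 0 < g) : cor (g * a) (g * b) = cor a b := by
  have hg' : (g:ℝ) ≠ 0 := by exact_mod_cast hg.ne'
  unfold cor
  have h1 := intervalIntegral.integral_comp_mul_left (fun x => saw (a * x) * saw (b * x)) (a := 0) (b := 1) hg'
  have h2 := (per_saw2 a b).intervalIntegral_add_zsmul_eq (g : ℤ) 0 (fun u v => ii_saw2 _ _ u v)
  simp only [zero_add, zsmul_eq_mul, mul_one, Int.cast_natCast] at h2
  have h3 : ∀ x : ℝ, saw ((g * a : ℕ) * x) * saw ((g * b : ℕ) * x) = saw (a * (g * x)) * saw (b * (g * x)) := by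
    intro x; push_cast; ring_nf
  simp_rw [h3]
  rw [h1, mul_zero, mul_one, h2, smul_eq_mul, ← mul_assoc, inv_mul_cancel₀ hg', one_mul]

lemma cor_step (a b : ℕ) (hb : 0 < b) (hab : Nat.Coprime a b) : (b : ℝ) * cor a b = cor 1 a := by
  have hb' : (b:ℝ) ≠ 0 := by exact_mod_cast hb.ne'
  have h1 : ∀ j ∈ Finset.range b, cor a b = ∫ x in (0:ℝ)..1, saw (a * x + a * j / b) * saw (b * x) := by
    intro j _
    have h2 := (per_saw2 a b).intervalIntegral_add_eq 0 ((j:ℝ) / b)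
    have h3 := intervalIntegral.integral_comp_add_right (fun x : ℝ => saw (a * x) * saw (b * x)) (a := 0) (b := 1) ((j:ℝ)/b)
    unfold cor
    rw [zero_add] at h2 h3
    rw [h2, add_comm ((j:ℝ)/b) 1, ← h3]
    congr 1
    ext x
    have e1 : (b:ℝ) * (x + j / b) = b * x + j := by field_simp
    rw [e1, saw_add_nat]
    ring_nf
  have h2 : (b : ℝ) * cor a b = ∑ j ∈ Finset.range b, ∫ x in (0:ℝ)..1, saw (a * x + a * j / b) * saw (b * x) := by
    rw [← Finset.sum_congr rfl h1]; simp
  rw [h2, ← intervalIntegral.integral_finsetSum, ← cor_scale 1 a b hb]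
  · unfold cor
    congr 1
    ext x
    rw [← Finset.sum_mul, saw_avg a b hb hab, mul_comm]
    push_cast; ring_nf
  · intro j _
    apply ii_of_bdd _ _ 1
    · intro x
      rw [abs_mul]
      exact mul_le_one₀ (saw_bd _) (abs_nonneg _) (saw_bd _)
    · refine Measurable.mul ?_ (saw_meas b)
      unfold saw
      exact (measurable_fract.comp ((measurable_const.mul measurable_id).add_const _)).sub_const _

lemma cor_one : cor 1 1 = 1 / 12 := by
  unfold cor
  have : ∫ x in (0:ℝ)..1, saw ((1:ℕ) * x) * saw ((1:ℕ) * x) = ∫ x in (0:ℝ)..1, (x ^ 2 - x + 1 / 4) := by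
    apply intervalIntegral.integral_congr_ae
    have : ∀ᵐ x : ℝ, x ≠ 1 := by simp [ae_iff, measure_singleton]
    filter_upwards [this] with x hx hm
    rw [Set.uIoc_of_le (by norm_num)] at hm
    have h : Int.fract x = x := Int.fract_eq_self.mpr ⟨hm.1.le, lt_of_le_of_ne hm.2 hx⟩
    simp only [saw, Nat.cast_one, one_mul, h]
    ring
  rw [this, intervalIntegral.integral_add, intervalIntegral.integral_sub]
  · simp; norm_num
  all_goals apply Continuous.intervalIntegrable; fun_prop

lemma cor_eq (a b : ℕ) (ha : 0 < a) (hb : 0 < b) :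
    cor a b = (Nat.gcd a b : ℝ) ^ 2 / (12 * a * b) := by
  obtain ⟨g, a', b', hg, hco, rfl, rfl⟩ := Nat.exists_coprime' (m := a) (n := b) (Nat.gcd_pos_of_pos_left b ha)
  have ha' : 0 < a' := Nat.pos_of_mul_pos_right ha
  have hb' : 0 < b' := Nat.pos_of_mul_pos_right hb
  rw [mul_comm a', mul_comm b', cor_scale _ _ _ hg, Nat.gcd_mul_left, hco]
  have h1 := cor_step a' b' hb' hco
  have h2 := cor_step 1 a' ha' (Nat.coprime_one_left a')
  rw [cor_one] at h2
  have q1 : (a' : ℝ) ≠ 0 := by exact_mod_cast ha'.ne'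
  have q2 : (b' : ℝ) ≠ 0 := by exact_mod_cast hb'.ne'
  have q3 : (g : ℝ) ≠ 0 := by exact_mod_cast hg.ne'
  push_cast
  rw [← h1] at h2
  field_simp at h2 ⊢
  linarith

lemma err_sq (n : ℕ) : ∫ x in (0:ℝ)..1, err n x ^ 2 = 
    ∑ a ∈ Finset.Icc 1 n, ∑ b ∈ Finset.Icc 1 n, mert (n / a) * mert (n / b) * cor a b := by
  have h : ∀ x, err n x ^ 2 = ∑ a ∈ Finset.Icc 1 n, ∑ b ∈ Finset.Icc 1 n, 
     mert (n / a) * mert (n / b) * (saw (a * x) * saw (b * x)) := by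
    intro x
    unfold err
    rw [sq, Finset.sum_mul_sum]
    refine Finset.sum_congr rfl fun a _ => Finset.sum_congr rfl fun b _ => by ring
  simp_rw [h]
  rw [intervalIntegral.integral_finsetSum]
  · refine Finset.sum_congr rfl fun a _ => ?_
    rw [intervalIntegral.integral_finsetSum]
    · refine Finset.sum_congr rfl fun b _ => ?_
      rw [intervalIntegral.integral_const_mul, cor]
    · intro b _; exact (ii_saw2 _ _ _ _).const_mul _
  · intro a _
    have := IntervalIntegrable.sum (Finset.Icc 1 n) (fun b _ => (ii_saw2 a b 0 1).const_mul (mert (n / a) * mert (n / b)))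
    convert! this using 1
    ext x; simp

/-- gcd sum bound -/
lemma gcd_sum (n : ℕ) (δ : ℝ) (hδ : 0 < δ) :
    ∑ a ∈ Finset.Icc 1 n, ∑ b ∈ Finset.Icc 1 n, (Nat.gcd a b : ℝ) ^ 2 * ((a : ℝ) ^ (-(3/2 + δ)) * (b : ℝ) ^ (-(3/2 + δ)))
      ≤ (∑' m : ℕ, (m : ℝ) ^ (-(1 + 2 * δ))) * (∑' m : ℕ, (m : ℝ) ^ (-(3/2 + δ))) ^ 2 := by
  set w : ℕ → ℝ := fun m => (m : ℝ) ^ (-(3/2 + δ)) with hw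
  have hw0 : ∀ m, 0 ≤ w m := fun m => by positivity
  have s1 : Summable w := Real.summable_nat_rpow.mpr (by linarith)
  have s2 : Summable (fun m : ℕ => (m : ℝ) ^ (-(1 + 2 * δ))) := Real.summable_nat_rpow.mpr (by linarith)
  have b1 : ∀ a ∈ Finset.Icc 1 n, ∀ b ∈ Finset.Icc 1 n, (Nat.gcd a b : ℝ) ^ 2 * (w a * w b) ≤ 
     ∑ g ∈ Finset.Icc 1 n, (g : ℝ) ^ 2 * ((if g ∣ a then w a else 0) * (if g ∣ b then w b else 0)) := by
    intro a ha b hb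
    rw [Finset.mem_Icc] at ha hb
    have hg : Nat.gcd a b ∈ Finset.Icc 1 n := by
      rw [Finset.mem_Icc]
      exact ⟨Nat.gcd_pos_of_pos_left b ha.1, (Nat.gcd_le_left b ha.1).trans ha.2⟩
    have := Finset.single_le_sum (f := fun g : ℕ => (g : ℝ) ^ 2 * ((if g ∣ a then w a else 0) * (if g ∣ b then w b else 0)))
      (fun g _ => by have := hw0 a; have := hw0 b; positivity) hg
    simpa [Nat.gcd_dvd_left, Nat.gcd_dvd_right] using this
  have b2 : ∀ g ∈ Finset.Icc 1 n, ∑ a ∈ Finset.Icc 1 n, (if g ∣ a then w a else 0) ≤ w g * ∑' m, w m := by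
    intro g hg
    rw [Finset.mem_Icc] at hg
    have : ∑ a ∈ Finset.Icc 1 n, (if g ∣ a then w a else 0) ≤ ∑ m ∈ Finset.Icc 1 n, w (g * m) := by
      rw [← Finset.sum_filter]
      have hsub : (Finset.Icc 1 n).filter (g ∣ ·) ⊆ (Finset.Icc 1 n).image (g * ·) := by
        intro a ha
        rw [Finset.mem_filter, Finset.mem_Icc] at ha
        obtain ⟨⟨h1, h2⟩, c, rfl⟩ := ha
        rw [Finset.mem_image]
        refine ⟨c, ?_, rfl⟩
        rw [Finset.mem_Icc]
        exact ⟨Nat.pos_of_mul_pos_left h1, (Nat.le_mul_of_pos_left c hg.1).trans h2⟩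
      refine (Finset.sum_le_sum_of_subset_of_nonneg hsub fun _ _ _ => hw0 _).trans ?_
      rw [Finset.sum_image (fun x _ y _ hxy => Nat.eq_of_mul_eq_mul_left hg.1 hxy)]
    refine this.trans ?_
    have h2 : ∀ m ∈ Finset.Icc 1 n, w (g * m) = w g * w m := by
      intro m _
      simp only [hw]; push_cast
      rw [Real.mul_rpow (by positivity) (by positivity)]
    rw [Finset.sum_congr rfl h2, ← Finset.mul_sum]
    exact mul_le_mul_of_nonneg_left (s1.sum_le_tsum _ fun m _ => hw0 m) (hw0 g)
  calc _ ≤ ∑ a ∈ Finset.Icc 1 n, ∑ b ∈ Finset.Icc 1 n, ∑ g ∈ Finset.Icc 1 n, (g : ℝ) ^ 2 * ((if g ∣ a then w a else 0) * (if g ∣ b then w b else 0)) :=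
        Finset.sum_le_sum fun a ha => Finset.sum_le_sum fun b hb => b1 a ha b hb
    _ = ∑ g ∈ Finset.Icc 1 n, (g : ℝ) ^ 2 * (∑ a ∈ Finset.Icc 1 n, (if g ∣ a then w a else 0)) ^ 2 := by
        simp_rw [sq (∑ a ∈ Finset.Icc 1 n, _), Finset.sum_mul_sum, Finset.mul_sum]
        rw [Finset.sum_comm_cycle]
    _ ≤ ∑ g ∈ Finset.Icc 1 n, (g : ℝ) ^ (-(1 + 2 * δ)) * (∑' m, w m) ^ 2 := by
        refine Finset.sum_le_sum fun g hg => ?_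
        have hb := b2 g hg
        rw [Finset.mem_Icc] at hg
        have hg0 : (0:ℝ) < g := by exact_mod_cast hg.1
        have : (g : ℝ) ^ (-(1 + 2 * δ)) = (g : ℝ) ^ 2 * (w g) ^ 2 := by
          simp only [hw]
          rw [← Real.rpow_natCast, ← Real.rpow_natCast, ← Real.rpow_mul hg0.le, ← Real.rpow_add hg0]
          congr 1; push_cast; ring
        rw [this, mul_assoc, ← mul_pow (w g)]
        refine mul_le_mul_of_nonneg_left (pow_le_pow_left₀ ?_ hb 2) (by positivity)
        exact Finset.sum_nonneg fun a _ => by have := hw0 a; positivity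
    _ ≤ _ := by
        rw [← Finset.sum_mul]
        refine mul_le_mul_of_nonneg_right (s2.sum_le_tsum _ fun m _ => by positivity) (by positivity)

theorem err_bound (δ : ℝ) (hδ : 0 < δ) (C : ℝ) (hM : ∀ m : ℕ, |mert m| ≤ C * (m : ℝ) ^ (1/2 + δ)) :
    ∃ K : ℝ, ∀ n : ℕ, 1 ≤ n → ∫ x in (0:ℝ)..1, |err n x| ≤ K * (n : ℝ) ^ (1/2 + δ) := by
  have hC : 0 ≤ C := by have := hM 1; simp at this; exact (abs_nonneg _).trans this
  set Z := (∑' m : ℕ, (m : ℝ) ^ (-(1 + 2 * δ))) * (∑' m : ℕ, (m : ℝ) ^ (-(3/2 + δ))) ^ 2 with hZ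
  refine ⟨(C ^ 2 * Z + 1) / 2, fun n hn => ?_⟩
  have hn0 : (0:ℝ) < n := by exact_mod_cast hn
  set T : ℝ := (n : ℝ) ^ (1/2 + δ) with hT
  have hT0 : 0 < T := by positivity
  have ie : IntervalIntegrable (err n) volume 0 1 := ii_of_bdd _ (err_meas n) _ (err_bd n) 0 1
  have ie2 : IntervalIntegrable (fun x => err n x ^ 2) volume 0 1 := by
    apply ii_of_bdd _ ((err_meas n).pow_const 2) ((∑ k ∈ Finset.Icc 1 n, |mert (n / k)|) ^ 2)
    intro x
    rw [abs_pow]; exact pow_le_pow_left₀ (abs_nonneg _) (err_bd n x) 2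
  have sq : ∫ x in (0:ℝ)..1, err n x ^ 2 ≤ C ^ 2 * T ^ 2 * Z := by
    rw [err_sq]
    refine le_trans ?_ (mul_le_mul_of_nonneg_left (gcd_sum n δ hδ) (by positivity))
    rw [Finset.mul_sum]
    refine Finset.sum_le_sum fun a ha => ?_
    rw [Finset.mul_sum]
    refine Finset.sum_le_sum fun b hb => ?_
    rw [Finset.mem_Icc] at ha hb
    have ha0 : (0:ℝ) < a := by exact_mod_cast ha.1
    have hb0 : (0:ℝ) < b := by exact_mod_cast hb.1
    have key : ∀ a : ℕ, 1 ≤ a → |mert (n / a)| ≤ C * T * (a : ℝ) ^ (-(1/2 + δ)) := by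
      intro a ha
      have ha0 : (0:ℝ) < a := by exact_mod_cast ha
      refine (hM _).trans ?_
      rw [mul_assoc]
      refine mul_le_mul_of_nonneg_left ?_ hC
      rw [hT, Real.rpow_neg ha0.le, ← div_eq_mul_inv, ← Real.div_rpow hn0.le ha0.le]
      exact Real.rpow_le_rpow (by positivity) Nat.cast_div_le (by linarith)
    have e : ∀ x : ℝ, 0 < x → x ^ (-(3/2 + δ)) = x ^ (-(1/2 + δ)) / x := by
      intro x hx
      rw [← Real.rpow_sub_one hx.ne']; congr 1; ring
    rw [cor_eq a b ha.1 hb.1, e _ ha0, e _ hb0]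
    have m1 : mert (n / a) * mert (n / b) ≤ (C * T * (a : ℝ) ^ (-(1/2 + δ))) * (C * T * (b : ℝ) ^ (-(1/2 + δ))) := by
      refine (le_abs_self _).trans ?_
      rw [abs_mul]
      exact mul_le_mul (key a ha.1) (key b hb.1) (abs_nonneg _) (by positivity)
    have hp : 0 ≤ (C * T * (a : ℝ) ^ (-(1/2 + δ))) * (C * T * (b : ℝ) ^ (-(1/2 + δ))) := by positivity
    calc _ ≤ (C * T * (a : ℝ) ^ (-(1/2 + δ))) * (C * T * (b : ℝ) ^ (-(1/2 + δ))) * ((Nat.gcd a b : ℝ) ^ 2 / (12 * a * b)) :=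
          mul_le_mul_of_nonneg_right m1 (by positivity)
      _ ≤ (C * T * (a : ℝ) ^ (-(1/2 + δ))) * (C * T * (b : ℝ) ^ (-(1/2 + δ))) * ((Nat.gcd a b : ℝ) ^ 2 / (a * b)) := by
          refine mul_le_mul_of_nonneg_left ?_ hp
          apply div_le_div_of_nonneg_left (by positivity) (by positivity)
          have : 0 < (a : ℝ) * b := by positivity
          nlinarith
      _ = _ := by field_simp
  have pt : ∀ x, |err n x| ≤ err n x ^ 2 / (2 * T) + T / 2 := by
    intro x
    have h : 0 ≤ (|err n x| - T) ^ 2 := sq_nonneg _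
    rw [sub_sq, sq_abs] at h
    rw [div_add_div _ _ (by positivity) (by positivity), le_div_iff₀ (by positivity)]
    nlinarith
  calc ∫ x in (0:ℝ)..1, |err n x| ≤ ∫ x in (0:ℝ)..1, (err n x ^ 2 / (2 * T) + T / 2) :=
        intervalIntegral.integral_mono_on (by norm_num) ie.abs ((ie2.div_const _).add (by simp)) fun x _ => pt x
    _ = (∫ x in (0:ℝ)..1, err n x ^ 2) / (2 * T) + T / 2 := by
        rw [intervalIntegral.integral_add (ie2.div_const _) (by simp), intervalIntegral.integral_div]; simp
    _ ≤ C ^ 2 * T ^ 2 * Z / (2 * T) + T / 2 := by gcongr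
    _ = _ := by field_simp

end FranelAux

namespace FranelAux
open MeasureTheory

noncomputable def Jint (S : ℝ → ℂ) (s : ℂ) : ℂ := ∫ t in Set.Ioi (1:ℝ), S t * (t : ℂ) ^ (-(s + 1))

lemma Jint_int (S : ℝ → ℂ) (hS : Measurable S) (C r : ℝ) (hC : ∀ t : ℝ, 1 < t → ‖S t‖ ≤ C * t ^ r) (s : ℂ) (hs : r < s.re) :
    IntegrableOn (fun t : ℝ => S t * (t : ℂ) ^ (-(s + 1))) (Set.Ioi 1) := by
  have h : IntegrableOn (fun t : ℝ => C * t ^ (r - s.re - 1)) (Set.Ioi 1) :=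
    (integrableOn_Ioi_rpow_of_lt (by linarith) one_pos).const_mul C
  refine Integrable.mono' h ?_ ?_
  · refine (hS.mul ?_).aestronglyMeasurable
    exact (Complex.measurable_ofReal.pow_const _)
  · refine (ae_restrict_iff' measurableSet_Ioi).mpr (Eventually.of_forall fun t ht => ?_)
    have ht0 : (0:ℝ) < t := lt_trans one_pos ht
    rw [norm_mul, Complex.norm_cpow_eq_rpow_re_of_pos ht0]
    have : t ^ (r - s.re - 1) = t ^ r * t ^ ((-(s + 1)).re) := by
      rw [← Real.rpow_add ht0]; congr 1; simp; ring
    rw [this, ← mul_assoc]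
    exact mul_le_mul_of_nonneg_right (hC t ht) (by positivity)

lemma Jint_diff (S : ℝ → ℂ) (hS : Measurable S) (C r : ℝ) (hC : ∀ t : ℝ, 1 < t → ‖S t‖ ≤ C * t ^ r)
    (s : ℂ) (hs : r < s.re) : DifferentiableAt ℂ (Jint S) s := by
  have hC0 : 0 ≤ C := by
    have := (norm_nonneg _).trans (hC 2 (by norm_num))
    by_contra h
    push Not at h
    have h2 : (0:ℝ) < 2 ^ r := by positivity
    nlinarith
  set f : ℝ → ℂ := Set.indicator (Set.Ioi 1) S with hf
  have e : Jint S = fun s => mellin f (-s) := by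
    ext s
    unfold Jint mellin
    rw [← MeasureTheory.integral_indicator measurableSet_Ioi, ← MeasureTheory.integral_indicator measurableSet_Ioi]
    congr 1
    ext t
    simp only [Set.indicator_apply, hf, Set.mem_Ioi, smul_eq_mul]
    by_cases h1 : 1 < t
    · have : 0 < t := by linarith
      simp only [h1, this, if_true]
      rw [mul_comm]; congr 2; ring
    · simp [h1]
  rw [e]
  have hm : Measurable f := hS.indicator measurableSet_Ioi
  have hb : ∀ t, 0 < t → ‖f t‖ ≤ C * t ^ r := by
    intro t ht
    simp only [hf, Set.indicator_apply, Set.mem_Ioi]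
    split_ifs with h
    · exact hC t h
    · simp; positivity
  have hloc : LocallyIntegrableOn f (Set.Ioi 0) := by
    have h1 : LocallyIntegrableOn (fun t : ℝ => Set.indicator (Set.Ioi 0) (fun t : ℝ => C * t ^ r) t) (Set.Ioi 0) := by
      refine ContinuousOn.locallyIntegrableOn ?_ measurableSet_Ioi
      have : ContinuousOn (fun t : ℝ => C * t ^ r) (Set.Ioi 0) := by
        refine continuousOn_const.mul (continuousOn_id.rpow_const fun t ht => Or.inl (ne_of_gt ht))
      refine this.congr fun t ht => ?_
      rw [Set.indicator_of_mem ht]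
    refine h1.mono hm.aestronglyMeasurable (Eventually.of_forall fun t => ?_)
    by_cases ht : 0 < t
    · rw [Set.indicator_of_mem (show t ∈ Set.Ioi (0:ℝ) from ht)]
      exact (hb t ht).trans (le_abs_self _)
    · have : f t = 0 := by
        rw [hf, Set.indicator_of_notMem]; simp; linarith
      rw [this]; simp
  have htop : f =O[atTop] (fun t : ℝ => t ^ (-(-r))) := by
    rw [neg_neg]
    refine Asymptotics.IsBigO.of_bound C ?_
    filter_upwards [eventually_gt_atTop 0] with t ht
    rw [Real.norm_eq_abs, abs_of_nonneg (by positivity)]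
    exact hb t ht
  have hbot : f =O[nhdsWithin 0 (Set.Ioi 0)] (fun t : ℝ => t ^ (-(-s.re - 1))) := by
    refine Asymptotics.IsBigO.of_bound 1 ?_
    have : Set.Iio (1:ℝ) ∈ nhdsWithin 0 (Set.Ioi 0) := mem_nhdsWithin_of_mem_nhds (Iio_mem_nhds one_pos)
    filter_upwards [this] with t ht
    have : f t = 0 := by
      rw [hf, Set.indicator_of_notMem]; simp; exact le_of_lt ht
    rw [this]; simp
  have hd := mellin_differentiableAt_of_isBigO_rpow (s := -s) hloc htop (by simpa using hs) hbot (by simp)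
  exact hd.comp s differentiableAt_id.neg

/-- `∫ {t} t^{-s-1}` -/
noncomputable def Ifr (s : ℂ) : ℂ := Jint (fun t => ((Int.fract t : ℝ) : ℂ)) s

lemma fr_meas : Measurable (fun t : ℝ => ((Int.fract t : ℝ) : ℂ)) := Complex.measurable_ofReal.comp measurable_fract

lemma fr_bd (t : ℝ) (_ : 1 < t) : ‖((Int.fract t : ℝ) : ℂ)‖ ≤ 1 * t ^ (0:ℝ) := by
  rw [Complex.norm_real, Real.norm_eq_abs, abs_of_nonneg (Int.fract_nonneg t)]
  simpa using (Int.fract_lt_one t).le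

lemma Ifr_bd (s : ℂ) (hs : 0 < s.re) : ‖Ifr s‖ ≤ 1 / s.re := by
  unfold Ifr Jint
  have h : IntegrableOn (fun t : ℝ => t ^ (-(s.re + 1))) (Set.Ioi 1) :=
    (integrableOn_Ioi_rpow_of_lt (by linarith) one_pos)
  have := norm_integral_le_of_norm_le h (f := fun t : ℝ => ((Int.fract t : ℝ) : ℂ) * (t : ℂ) ^ (-(s + 1))) ?_
  · rw [integral_Ioi_rpow_of_lt (by linarith) one_pos] at this
    refine this.trans (le_of_eq ?_)
    rw [Real.one_rpow]
    have h1 : -(s.re + 1) + 1 = - s.re := by ring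
    rw [h1, neg_div_neg_eq]
  · refine (ae_restrict_iff' measurableSet_Ioi).mpr (Eventually.of_forall fun t ht => ?_)
    have ht0 : (0:ℝ) < t := lt_trans one_pos ht
    rw [norm_mul, Complex.norm_cpow_eq_rpow_re_of_pos ht0]
    have h2 := fr_bd t ht
    rw [Real.rpow_zero, mul_one] at h2
    have h3 : (-(s+1)).re = -(s.re + 1) := by simp
    rw [h3]
    exact mul_le_of_le_one_left (by positivity) h2

/-- `(s-1) ζ(s)` -/
noncomputable def Fz (s : ℂ) : ℂ := s - s * (s - 1) * Ifr s

lemma Fz_diff (s : ℂ) (hs : 0 < s.re) : DifferentiableAt ℂ Fz s := by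
  have : DifferentiableAt ℂ Ifr s := Jint_diff _ fr_meas 1 0 fr_bd s hs
  unfold Fz
  fun_prop

lemma Fz_one : Fz 1 = 1 := by simp [Fz]

lemma Fz_bd (s : ℂ) (hs : 1 / 2 ≤ s.re) : ‖Fz s‖ ≤ 4 * (‖s‖ + 1) ^ 2 := by
  have h := Ifr_bd s (by linarith)
  have h2 : 1 / s.re ≤ 2 := by
    rw [div_le_iff₀ (by linarith)]; linarith
  have h3 : ‖s - 1‖ ≤ ‖s‖ + 1 := by simpa using norm_sub_le s 1
  unfold Fz
  have h4 : ‖s * (s - 1) * Ifr s‖ ≤ ‖s‖ * (‖s‖ + 1) * 2 := by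
    rw [norm_mul, norm_mul]
    gcongr
    exact h.trans h2
  refine (norm_sub_le _ _).trans ?_
  have := norm_nonneg s
  nlinarith

lemma Fz_eq_of_one_lt (s : ℂ) (hs : 1 < s.re) : Fz s = (s - 1) * riemannZeta s := by
  have hs1 : s - 1 ≠ 0 := by intro h; rw [sub_eq_zero] at h; rw [h] at hs; simp at hs
  have h1 : LSeries (fun _ => (1:ℂ)) s = s * ∫ t in Set.Ioi (1 : ℝ), (∑ k ∈ Finset.Icc 1 ⌊t⌋₊, (1:ℂ)) * (t : ℂ) ^ (-(s + 1)) := by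
    apply LSeries_eq_mul_integral' (r := 1) _ (by norm_num) hs
    refine Asymptotics.IsBigO.of_bound 1 (Eventually.of_forall fun n => ?_)
    simp
  have hz : LSeries (fun _ => (1:ℂ)) s = riemannZeta s := LSeries_one_eq_riemannZeta hs
  rw [hz] at h1
  have h2 : ∫ t in Set.Ioi (1 : ℝ), (∑ k ∈ Finset.Icc 1 ⌊t⌋₊, (1:ℂ)) * (t : ℂ) ^ (-(s + 1)) 
      = ∫ t in Set.Ioi (1:ℝ), ((t:ℂ) ^ (-s) - ((Int.fract t : ℝ) : ℂ) * (t : ℂ) ^ (-(s + 1))) := by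
    apply setIntegral_congr_fun measurableSet_Ioi
    intro t ht
    have ht0 : (0:ℝ) < t := lt_trans one_pos ht
    have htc : (t:ℂ) ≠ 0 := by exact_mod_cast ht0.ne'
    simp only [Finset.sum_const, Nat.card_Icc, nsmul_eq_mul, mul_one, Nat.add_sub_cancel]
    have e1 : ((⌊t⌋₊ : ℕ) : ℂ) = (t : ℂ) - ((Int.fract t : ℝ) : ℂ) := by
      have : ((⌊t⌋₊ : ℕ) : ℝ) = t - Int.fract t := by
        rw [natCast_floor_eq_intCast_floor ht0.le, Int.self_sub_fract]
      rw [← Complex.ofReal_natCast, this]; push_cast; rfl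
    have e2 : (t:ℂ) ^ (-s) = t * (t : ℂ) ^ (-(s + 1)) := by
      rw [show -s = 1 + (-(s+1)) by ring, Complex.cpow_add _ _ htc, Complex.cpow_one]
    rw [e1, e2]; ring
  have i1 : IntegrableOn (fun t : ℝ => (t:ℂ) ^ (-s)) (Set.Ioi 1) := integrableOn_Ioi_cpow_of_lt (by simpa using hs) one_pos
  rw [h2, integral_sub i1 (Jint_int _ fr_meas 1 0 fr_bd s (by linarith)),
    integral_Ioi_cpow_of_lt (by simpa using hs) one_pos] at h1
  rw [h1]
  unfold Fz Ifr Jint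
  have : -s + 1 ≠ 0 := by intro h; apply hs1; linear_combination -h
  simp only [Complex.ofReal_one, Complex.one_cpow]
  field_simp
  ring

lemma isPreconn (r : ℝ) : IsPreconnected {s : ℂ | r < s.re} := (convex_halfSpace_re_gt r).isPreconnected

lemma isOpen_hp (r : ℝ) : IsOpen {s : ℂ | r < s.re} := isOpen_lt continuous_const Complex.continuous_re

lemma ident (r : ℝ) (f g : ℂ → ℂ) (hf : ∀ s : ℂ, r < s.re → DifferentiableAt ℂ f s)
    (hg : ∀ s : ℂ, r < s.re → DifferentiableAt ℂ g s) (h : ∀ s : ℂ, 1 < s.re → f s = g s) (s : ℂ) (hs : r < s.re) :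
    f s = g s := by
  have hf' : AnalyticOnNhd ℂ f {s : ℂ | r < s.re} :=
    DifferentiableOn.analyticOnNhd (fun s hs => (hf s hs).differentiableWithinAt) (isOpen_hp r)
  have hg' : AnalyticOnNhd ℂ g {s : ℂ | r < s.re} :=
    DifferentiableOn.analyticOnNhd (fun s hs => (hg s hs).differentiableWithinAt) (isOpen_hp r)
  set z : ℂ := ((max r 1 + 1 : ℝ) : ℂ) with hz
  have hzr : z.re = max r 1 + 1 := by simp [hz]
  have h1 : 1 < z.re := by rw [hzr]; have := le_max_right r 1; linarith
  have h2 : r < z.re := by rw [hzr]; have := le_max_left r 1; linarith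
  refine hf'.eqOn_of_preconnected_of_eventuallyEq hg' (isPreconn r) (z₀ := z) h2 ?_ hs
  filter_upwards [(isOpen_hp 1).mem_nhds h1] with w hw using h w hw

lemma Fz_eq (s : ℂ) (hs : 0 < s.re) (hs1 : s ≠ 1) : Fz s = (s - 1) * riemannZeta s := by
  have h := ident 0 (fun s => (s - 1) * Fz s) (fun s => (s - 1) ^ 2 * riemannZeta s) 
    (fun s hs => by have := Fz_diff s hs; fun_prop) ?_ (fun s hs => by rw [Fz_eq_of_one_lt s hs]; ring) s hs
  · have h0 : s - 1 ≠ 0 := sub_ne_zero.mpr hs1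
    apply mul_left_cancel₀ h0
    rw [h]; ring
  · intro s _
    by_cases h : s = 1
    · subst h
      have : HasDerivAt (fun s : ℂ => (s - 1) ^ 2 * riemannZeta s) 1 1 := by
        rw [hasDerivAt_iff_tendsto_slope]
        refine riemannZeta_residue_one.congr' ?_
        filter_upwards [self_mem_nhdsWithin] with w hw
        have : w - 1 ≠ 0 := sub_ne_zero.mpr hw
        simp only [slope, vsub_eq_sub, sub_self, smul_eq_mul]
        field_simp
        ring
      exact this.differentiableAt
    · have := differentiableAt_riemannZeta h
      fun_prop

lemma mert_bd (n : ℕ) : |mert n| ≤ n := by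
  unfold mert
  refine (Finset.abs_sum_le_sum_abs _ _).trans ?_
  refine (Finset.sum_le_sum (g := fun _ => (1:ℝ)) fun k _ => ?_).trans (by simp)
  have := ArithmeticFunction.abs_moebius_le_one (n := k)
  exact_mod_cast this

theorem RH_of_mert (H : ∀ ε : ℝ, 0 < ε → ∃ C : ℝ, ∀ m : ℕ, |mert m| ≤ C * (m : ℝ) ^ (1 / 2 + ε)) :
    ∀ s : ℂ, riemannZeta s = 0 → 0 < s.re → s.re < 1 → s.re = 1 / 2 := by
  have main : ∀ s : ℂ, riemannZeta s = 0 → 1 / 2 < s.re → s.re < 1 → False := by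
    intro s hz h1 h2
    set ε := (s.re - 1 / 2) / 2 with hε
    have hε0 : 0 < ε := by rw [hε]; linarith
    obtain ⟨C, hC⟩ := H ε hε0
    have hC0 : 0 ≤ C := by have := hC 1; simp at this; exact (abs_nonneg _).trans this
    set S : ℝ → ℂ := fun t => ∑ k ∈ Finset.Icc 1 ⌊t⌋₊, ((ArithmeticFunction.moebius k : ℤ) : ℂ) with hS
    have hSm : ∀ t, S t = (mert ⌊t⌋₊ : ℂ) := by
      intro t; simp only [hS]; unfold mert; push_cast; rfl
    have hmeas : Measurable S := by
      have : S = (fun n : ℕ => (mert n : ℂ)) ∘ (fun t : ℝ => ⌊t⌋₊) := by ext t; exact hSm t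
      rw [this]
      exact measurable_from_nat.comp Nat.measurable_floor
    have hbd : ∀ t : ℝ, 1 < t → ‖S t‖ ≤ C * t ^ (1 / 2 + ε) := by
      intro t ht
      rw [hSm, Complex.norm_real, Real.norm_eq_abs]
      refine (hC _).trans ?_
      refine mul_le_mul_of_nonneg_left ?_ hC0
      exact Real.rpow_le_rpow (by positivity) (Nat.floor_le (by linarith)) (by linarith)
    have hgt : ∀ s : ℂ, 1 < s.re → Fz s * (s * Jint S s) = s - 1 := by
      intro s hs
      have e1 : LSeries (fun n => ((ArithmeticFunction.moebius n : ℤ) : ℂ)) s = s * Jint S s := by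
        unfold Jint
        apply LSeries_eq_mul_integral' (r := 1) _ (by norm_num) hs
        refine Asymptotics.IsBigO.of_bound 1 (Eventually.of_forall fun n => ?_)
        rw [Real.norm_eq_abs, abs_of_nonneg (Finset.sum_nonneg fun _ _ => norm_nonneg _)]
        refine (Finset.sum_le_sum (g := fun _ => (1:ℝ)) fun k _ => ?_).trans (by simp)
        rw [Complex.norm_intCast]
        have := ArithmeticFunction.abs_moebius_le_one (n := k)
        exact_mod_cast this
      have e2 := ArithmeticFunction.LSeries_zeta_mul_Lseries_moebius hs
      rw [ArithmeticFunction.LSeries_zeta_eq_riemannZeta hs] at e2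
      rw [← e1, Fz_eq_of_one_lt s hs, mul_assoc, e2, mul_one]
    have := ident (1 / 2 + ε) (fun s => Fz s * (s * Jint S s)) (fun s => s - 1) (fun s hs => by
      have a1 := Fz_diff s (by linarith)
      have a2 := Jint_diff S hmeas C _ hbd s hs
      fun_prop) (fun s _ => by fun_prop) hgt s (by rw [hε]; linarith)
    have hs1 : s ≠ 1 := by rintro rfl; simp at h2
    rw [Fz_eq s (by linarith) hs1, hz] at this
    apply hs1
    linear_combination -this
  intro s hz h1 h2
  rcases lt_trichotomy s.re (1 / 2) with h | h | h
  · exfalso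
    refine main (1 - s) ?_ (by simp; linarith) (by simp; linarith)
    rw [riemannZeta_one_sub, hz, mul_zero]
    · rintro n rfl
      simp at h1
      have : (0:ℝ) ≤ n := by positivity
      linarith
    · rintro rfl; simp at h2
  · exact h
  · exact (main s hz h h2).elim

end FranelAux

namespace FranelAux
open MeasureTheory

lemma locallog (H : ℂ → ℂ) (c : ℂ) (R : ℝ) (hR : 0 < R) (hd : DifferentiableOn ℂ H (Metric.ball c R))
    (hne : ∀ z ∈ Metric.ball c R, H z ≠ 0) :
    ∃ f : ℂ → ℂ, f c = 0 ∧ ∀ z ∈ Metric.ball c R, HasDerivAt f (deriv H z / H z) z ∧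
      H z = H c * Complex.exp (f z) := by
  have hg : DifferentiableOn ℂ (fun z => deriv H z / H z) (Metric.ball c R) :=
    (hd.deriv Metric.isOpen_ball).div hd hne
  obtain ⟨f, hf0, hf⟩ := (hg.isExactOn_ball).with_val_at c 0
  refine ⟨f, hf0, fun z hz => ⟨hf z hz, ?_⟩⟩
  have hc : c ∈ Metric.ball c R := Metric.mem_ball_self hR
  have hder : ∀ w ∈ Metric.ball c R, HasDerivAt (fun w => H w * Complex.exp (-f w)) 0 w := by
    intro w hw
    have h1 := (hd.differentiableAt (Metric.isOpen_ball.mem_nhds hw)).hasDerivAt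
    have h2 := ((hf w hw).neg).cexp
    refine (h1.mul h2).congr_deriv ?_
    have e : H w * (deriv H w / H w) = deriv H w := mul_div_cancel₀ _ (hne w hw)
    change deriv H w * Complex.exp (-f w) + H w * (Complex.exp (-f w) * -(deriv H w / H w)) = 0
    linear_combination (-Complex.exp (-f w)) * e
  have := Metric.isOpen_ball.is_const_of_deriv_eq_zero (convex_ball c R).isPreconnected
    (fun w hw => (hder w hw).differentiableAt.differentiableWithinAt)
    (fun w hw => (hder w hw).deriv) hz hc
  simp only [hf0, neg_zero, Complex.exp_zero, mul_one] at this
  rw [← this, mul_assoc, ← Complex.exp_add]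
  simp

lemma logderiv_bd (H : ℂ → ℂ) (c : ℂ) (R r M : ℝ) (hr : 0 < r) (hR : r < R) (hM : 0 < M)
    (hd : DifferentiableOn ℂ H (Metric.ball c R))
    (hne : ∀ z ∈ Metric.ball c R, H z ≠ 0)
    (hb : ∀ z ∈ Metric.ball c R, ‖H z‖ ≤ ‖H c‖ * Real.exp M) (z : ℂ) (hz : ‖z - c‖ ≤ r) :
    ‖deriv H z / H z‖ ≤ 16 * M * R / (R - r) ^ 2 := by
  have hR0 : 0 < R := hr.trans hR
  obtain ⟨f, hf0, hf⟩ := locallog H c R hR0 hd hne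
  have hc : c ∈ Metric.ball c R := Metric.mem_ball_self hR0
  have hHc : 0 < ‖H c‖ := norm_pos_iff.mpr (hne c hc)
  have hre : ∀ w ∈ Metric.ball c R, (f w).re ≤ M := by
    intro w hw
    have h1 := hb w hw
    rw [(hf w hw).2, norm_mul, Complex.norm_exp] at h1
    exact Real.exp_le_exp.mp (le_of_mul_le_mul_left h1 hHc)
  have hfb : ∀ w, ‖w - c‖ ≤ (R + r) / 2 → ‖f w‖ ≤ 4 * M * R / (R - r) := by
    intro w hw
    have key := Complex.borelCaratheodory_zero (f := fun u => f (c + u)) (R := R) (z := w - c) hM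
      (by
        intro u hu
        have hu' : c + u ∈ Metric.ball c R := by simpa using hu
        exact (((hf _ hu').1.differentiableAt).comp u (by fun_prop)).differentiableWithinAt)
      (by
        intro u hu
        exact hre _ (by simpa using hu)) hR0 (by simp; linarith) (by simpa using hf0)
    simp only [add_sub_cancel] at key
    refine key.trans ?_
    rw [div_le_div_iff₀ (by linarith) (by linarith)]
    have h0 := norm_nonneg (w - c)
    have hx : 0 < R - r := by linarith
    have : ‖w - c‖ * (R - r) ≤ 2 * R * (R - ‖w - c‖) := by nlinarith
    nlinarith
  have hzb : z ∈ Metric.ball c R := by rw [mem_ball_iff_norm]; linarith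
  rw [← (hf z hzb).1.deriv]
  have hx : 0 < R - r := by linarith
  have := Complex.norm_deriv_le_of_forall_mem_sphere_norm_le (c := z) (R := (R - r) / 4) (f := f)
    (C := 4 * M * R / (R - r)) (by linarith) ?_ ?_
  · refine this.trans (le_of_eq ?_)
    field_simp; ring
  · apply DifferentiableOn.diffContOnCl
    intro w hw
    have hw := Metric.closure_ball_subset_closedBall hw
    rw [mem_closedBall_iff_norm] at hw
    have h2 : ‖w - c‖ ≤ ‖w - z‖ + ‖z - c‖ := norm_sub_le_norm_sub_add_norm_sub w z c
    exact (hf w (by rw [mem_ball_iff_norm]; linarith)).1.differentiableAt.differentiableWithinAt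
  · intro w hw
    rw [mem_sphere_iff_norm] at hw
    have h2 : ‖w - c‖ ≤ ‖w - z‖ + ‖z - c‖ := norm_sub_le_norm_sub_add_norm_sub w z c
    exact hfb w (by linarith)

lemma LS_bd (f : ℕ → ℂ) (s : ℂ) (x : ℝ) (hs : s.re = x) (hf : LSeriesSummable f (x : ℂ)) :
    ‖LSeries f s‖ ≤ ∑' n, ‖LSeries.term f (x : ℂ) n‖ := by
  unfold LSeries
  have : ∀ n, ‖LSeries.term f s n‖ = ‖LSeries.term f (x : ℂ) n‖ := by
    intro n
    rw [LSeries.norm_term_eq, LSeries.norm_term_eq, hs]; simp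
  simp_rw [← this]
  refine norm_tsum_le_tsum_norm ?_
  simp_rw [this]
  exact hf.norm

lemma exists_Z : ∃ Z : ℝ, 1 ≤ Z ∧ ∀ s : ℂ, s.re = 2 → ‖(riemannZeta s)⁻¹‖ ≤ Z := by
  refine ⟨max 1 (∑' n, ‖LSeries.term (fun n => ((ArithmeticFunction.moebius n : ℤ) : ℂ)) ((2:ℝ) : ℂ) n‖), le_max_left _ _, fun s hs => ?_⟩
  have h1 : 1 < s.re := by linarith
  have h := ArithmeticFunction.LSeries_zeta_mul_Lseries_moebius h1
  rw [ArithmeticFunction.LSeries_zeta_eq_riemannZeta h1] at h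
  have : (riemannZeta s)⁻¹ = LSeries (fun n => ((ArithmeticFunction.moebius n : ℤ) : ℂ)) s :=
    inv_eq_of_mul_eq_one_right h
  rw [this]
  refine (LS_bd _ s 2 hs ?_).trans (le_max_right _ _)
  exact ArithmeticFunction.LSeriesSummable_moebius_iff.mpr (by simp)

lemma exists_G : ∃ G : ℝ, 1 ≤ G ∧ ∀ s : ℂ, s.re = 2 → ‖deriv Fz s / Fz s‖ ≤ G := by
  refine ⟨1 + ∑' n, ‖LSeries.term (fun n => ((ArithmeticFunction.vonMangoldt n : ℝ) : ℂ)) ((2:ℝ) : ℂ) n‖, ?_, fun s hs => ?_⟩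
  · have : 0 ≤ ∑' n, ‖LSeries.term (fun n => ((ArithmeticFunction.vonMangoldt n : ℝ) : ℂ)) ((2:ℝ) : ℂ) n‖ := 
      tsum_nonneg fun n => norm_nonneg _
    linarith
  have h1 : 1 < s.re := by linarith
  have hs1 : s ≠ 1 := by rintro rfl; simp at h1
  have h := ArithmeticFunction.LSeries_vonMangoldt_eq_deriv_riemannZeta_div h1
  have hz := riemannZeta_ne_zero_of_one_le_re h1.le
  have hev : Fz =ᶠ[nhds s] fun s => (s - 1) * riemannZeta s := by
    filter_upwards [(isOpen_hp 1).mem_nhds h1] with w hw using Fz_eq_of_one_lt w hw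
  have hd : deriv Fz s = riemannZeta s + (s - 1) * deriv riemannZeta s := by
    rw [hev.deriv_eq]
    have h2 := (((hasDerivAt_id s).sub_const 1).mul (differentiableAt_riemannZeta hs1).hasDerivAt).deriv
    have h3 : deriv (fun s => (s - 1) * riemannZeta s) s = 1 * riemannZeta s + (s - 1) * deriv riemannZeta s := h2
    rw [h3, one_mul]
  have hs1' : s - 1 ≠ 0 := sub_ne_zero.mpr hs1
  have : deriv Fz s / Fz s = 1 / (s - 1) - LSeries (fun n => ((ArithmeticFunction.vonMangoldt n : ℝ) : ℂ)) s := by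
    rw [h, hd, Fz_eq_of_one_lt s h1]; field_simp; ring
  rw [this]
  refine (norm_sub_le _ _).trans (add_le_add ?_ (LS_bd _ s 2 hs ?_))
  · rw [norm_div, norm_one, div_le_one (norm_pos_iff.mpr hs1')]
    have := Complex.abs_re_le_norm (s - 1)
    simp only [Complex.sub_re, hs, Complex.one_re] at this
    norm_num at this
    exact this
  · exact ArithmeticFunction.LSeriesSummable_vonMangoldt (by simp)

end FranelAux

namespace FranelAux
open MeasureTheory

lemma log_ge_one (t : ℝ) : 1 ≤ Real.log (|t| + 10) := by
  rw [Real.le_log_iff_exp_le (by positivity)]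
  have := Real.exp_one_lt_d9
  have := abs_nonneg t
  linarith

lemma Fz_inv_two (Z : ℝ) (hZ : ∀ s : ℂ, s.re = 2 → ‖(riemannZeta s)⁻¹‖ ≤ Z) (t : ℝ) :
    ‖(Fz (⟨2, t⟩ : ℂ))⁻¹‖ ≤ Z * ‖((⟨2, t⟩ : ℂ) - 1)‖⁻¹ := by
  have h1 : (1:ℝ) < (⟨2, t⟩ : ℂ).re := by norm_num
  rw [Fz_eq_of_one_lt _ h1, mul_inv, norm_mul, norm_inv, mul_comm]
  exact mul_le_mul_of_nonneg_right (hZ _ rfl) (by positivity)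

lemma g_log (hne : ∀ s : ℂ, 1 / 2 < s.re → Fz s ≠ 0) (δ : ℝ) (hδ : 0 < δ) (hδ1 : δ < 1 / 2) :
    ∃ B : ℝ, 1 ≤ B ∧ ∀ s : ℂ, 1 / 2 + δ ≤ s.re → s.re ≤ 2 →
      ‖deriv Fz s / Fz s‖ ≤ B * Real.log (|s.im| + 10) := by
  obtain ⟨Z, hZ1, hZ⟩ := exists_Z
  set B0 := Real.log (4 * Z) + 2 with hB0
  have hl : 0 ≤ Real.log (4 * Z) := Real.log_nonneg (by linarith)
  refine ⟨max 1 (16 * B0 * (3 / 2) / δ ^ 2), le_max_left _ _, fun s h1 h2 => ?_⟩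
  set L := Real.log (|s.im| + 10) with hL
  have hL1 : 1 ≤ L := log_ge_one _
  have hball : ∀ z ∈ Metric.ball (⟨2, s.im⟩ : ℂ) (3 / 2), 1 / 2 < z.re := by
    intro z hz
    rw [mem_ball_iff_norm] at hz
    have := (abs_le.mp ((Complex.abs_re_le_norm (z - ⟨2, s.im⟩)))).1
    simp at this
    linarith
  have key := logderiv_bd Fz ⟨2, s.im⟩ (3 / 2) (3 / 2 - δ) (B0 * L) (by linarith) (by linarith) (by positivity)
    (fun z hz => (Fz_diff z (by linarith [hball z hz])).differentiableWithinAt)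
    (fun z hz => hne z (hball z hz)) ?_ s ?_
  · refine key.trans ?_
    have : 16 * (B0 * L) * (3 / 2) / (3 / 2 - (3 / 2 - δ)) ^ 2 = (16 * B0 * (3 / 2) / δ ^ 2) * L := by
      rw [sub_sub_cancel]; ring
    rw [this]
    exact mul_le_mul_of_nonneg_right (le_max_right _ _) (by linarith)
  · intro z hz
    have hzr := hball z hz
    rw [mem_ball_iff_norm] at hz
    have hzn : ‖z‖ ≤ |s.im| + 7 / 2 := by
      have e1 : ‖z‖ ≤ ‖z - ⟨2, s.im⟩‖ + ‖(⟨2, s.im⟩ : ℂ)‖ := by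
        simpa using norm_add_le (z - ⟨2, s.im⟩) (⟨2, s.im⟩ : ℂ)
      have e2 := Complex.norm_le_abs_re_add_abs_im (⟨2, s.im⟩ : ℂ)
      simp at e2
      linarith
    have hFz := Fz_bd z hzr.le
    have hc : Fz ⟨2, s.im⟩ ≠ 0 := hne _ (by norm_num)
    have hinv := Fz_inv_two Z hZ s.im
    have h3 : ‖((⟨2, s.im⟩ : ℂ) - 1)‖⁻¹ ≤ 1 := by
      apply inv_le_one_of_one_le₀
      have := Complex.abs_re_le_norm ((⟨2, s.im⟩ : ℂ) - 1)
      simp at this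
      norm_num at this
      exact this
    have h4 : 1 ≤ ‖Fz ⟨2, s.im⟩‖ * Z := by
      have : ‖Fz ⟨2, s.im⟩‖ * ‖(Fz (⟨2, s.im⟩ : ℂ))⁻¹‖ = 1 := by
        rw [← norm_mul, mul_inv_cancel₀ hc, norm_one]
      rw [← this]
      refine mul_le_mul_of_nonneg_left (hinv.trans ?_) (norm_nonneg _)
      nlinarith
    have h5 : Real.exp (B0 * L) ≥ 4 * Z * (|s.im| + 10) ^ 2 := by
      have e : Real.exp (Real.log (4 * Z) + 2 * L) = 4 * Z * (|s.im| + 10) ^ 2 := by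
        rw [Real.exp_add, Real.exp_log (by linarith), mul_comm 2 L, Real.exp_mul, Real.exp_log (by positivity)]
        norm_num
      rw [← e]
      apply Real.exp_le_exp.mpr
      rw [hB0]; nlinarith
    have h6 : 4 * (‖z‖ + 1) ^ 2 ≤ 4 * (|s.im| + 10) ^ 2 := by
      have e0 := norm_nonneg z
      have e1 : ‖z‖ + 1 ≤ |s.im| + 10 := by linarith
      have := pow_le_pow_left₀ (by linarith) e1 2
      linarith
    calc ‖Fz z‖ ≤ 4 * (|s.im| + 10) ^ 2 := hFz.trans h6
      _ ≤ (‖Fz ⟨2, s.im⟩‖ * Z) * (4 * (|s.im| + 10) ^ 2) := le_mul_of_one_le_left (by positivity) h4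
      _ = ‖Fz ⟨2, s.im⟩‖ * (4 * Z * (|s.im| + 10) ^ 2) := by ring
      _ ≤ _ := mul_le_mul_of_nonneg_left h5 (norm_nonneg _)
  · have : s - ⟨2, s.im⟩ = ((s.re - 2 : ℝ) : ℂ) := by
      apply Complex.ext <;> simp
    rw [this, Complex.norm_real, Real.norm_eq_abs, abs_of_nonpos (by linarith)]
    linarith

lemma g_pow (hne : ∀ s : ℂ, 1 / 2 < s.re → Fz s ≠ 0) (δ : ℝ) (hδ : 0 < δ) (hδ1 : δ < 1 / 2) :
    ∃ K θ : ℝ, 0 < K ∧ 0 < θ ∧ θ < 1 ∧ ∀ s : ℂ, 1 / 2 + 2 * δ ≤ s.re → s.re ≤ 2 →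
      ‖deriv Fz s / Fz s‖ ≤ K * Real.log (|s.im| + 10) ^ (1 - θ) := by
  obtain ⟨B, hB1, hB⟩ := g_log hne δ hδ hδ1
  obtain ⟨G, hG1, hG⟩ := exists_G
  set E := Real.exp 4 with hE
  have hE1 : 1 ≤ E := Real.one_le_exp (by norm_num)
  have hθ : 0 < δ / (3 / 2 - δ) := div_pos hδ (by linarith)
  have hθ1 : δ / (3 / 2 - δ) < 1 := by rw [div_lt_one (by linarith)]; linarith
  refine ⟨(E * B * 2) ^ (1 - δ / (3 / 2 - δ)) * (E * G), δ / (3 / 2 - δ), by positivity, hθ, hθ1, ?_⟩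
  intro s h1 h2
  set L := Real.log (|s.im| + 10) with hL
  have hL1 : 1 ≤ L := log_ge_one _
  set φ : ℂ → ℂ := fun z => (deriv Fz z / Fz z) * Complex.exp ((z - s.im * Complex.I) ^ 2) with hφ
  have hexp : ∀ z : ℂ, ‖Complex.exp ((z - s.im * Complex.I) ^ 2)‖ = Real.exp (z.re ^ 2 - (z.im - s.im) ^ 2) := by
    intro z
    rw [Complex.norm_exp]
    congr 1
    simp [pow_two]
  have hexpE : ∀ z : ℂ, 0 ≤ z.re → z.re ≤ 2 → Real.exp (z.re ^ 2 - (z.im - s.im) ^ 2) ≤ E * Real.exp (-(z.im - s.im) ^ 2) := by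
    intro z hz hz2
    rw [hE, ← Real.exp_add]
    apply Real.exp_le_exp.mpr
    nlinarith
  have hA : ∀ z : ℂ, 1 / 2 + δ ≤ z.re → z.re ≤ 2 → ‖φ z‖ ≤ E * B * 2 * L := by
    intro z hz hz2
    rw [hφ]; simp only
    rw [norm_mul, hexp]
    set u := |z.im - s.im| with hu
    have hlog : Real.log (|z.im| + 10) ≤ L + u := by
      have e1 : |z.im| + 10 ≤ (|s.im| + 10) * Real.exp u := by
        have a1 : |z.im| ≤ |s.im| + u := by
          have := abs_add_le s.im (z.im - s.im); simpa using this
        have a2 := Real.add_one_le_exp u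
        have a3 : 0 ≤ u := abs_nonneg _
        have a4 := abs_nonneg s.im
        nlinarith
      calc _ ≤ Real.log ((|s.im| + 10) * Real.exp u) := Real.log_le_log (by positivity) e1
        _ = L + u := by rw [Real.log_mul (by positivity) (by positivity), Real.log_exp]
    have hu0 : 0 ≤ u := abs_nonneg _
    have husq : (z.im - s.im) ^ 2 = u ^ 2 := (sq_abs _).symm
    have h3 : (L + u) * Real.exp (-(z.im - s.im) ^ 2) ≤ 2 * L := by
      rw [husq, Real.exp_neg]
      rw [← div_eq_mul_inv, div_le_iff₀ (Real.exp_pos _)]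
      have := Real.add_one_le_exp (u ^ 2)
      nlinarith [sq_nonneg (u - 1)]
    calc _ ≤ (B * (L + u)) * (E * Real.exp (-(z.im - s.im) ^ 2)) := by
          refine mul_le_mul ((hB z hz hz2).trans ?_) (hexpE z (by linarith) hz2) (Real.exp_pos _).le (by positivity)
          exact mul_le_mul_of_nonneg_left hlog (by linarith)
      _ = E * B * ((L + u) * Real.exp (-(z.im - s.im) ^ 2)) := by ring
      _ ≤ E * B * (2 * L) := mul_le_mul_of_nonneg_left h3 (by positivity)
      _ = _ := by ring
  have hdiff : DiffContOnCl ℂ φ (Complex.HadamardThreeLines.verticalStrip (1 / 2 + δ) 2) := by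
    apply DifferentiableOn.diffContOnCl
    have hO : DifferentiableOn ℂ Fz {z | 1 / 2 < z.re} := fun z hz =>
      (Fz_diff z (by have : 1 / 2 < z.re := hz; linarith)).differentiableWithinAt
    have hφd : DifferentiableOn ℂ φ {z | 1 / 2 < z.re} := by
      refine ((hO.deriv (isOpen_hp _)).div hO fun z hz => hne z hz).mul ?_
      fun_prop
    refine hφd.mono ?_
    have hcl : closure (Complex.HadamardThreeLines.verticalStrip (1 / 2 + δ) 2) ⊆ {z : ℂ | 1 / 2 + δ ≤ z.re} := by
      apply closure_minimal
      · intro z hz; exact hz.1.le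
      · exact isClosed_le continuous_const Complex.continuous_re
    intro z hz
    have := hcl hz
    simp only [Set.mem_ofPred_eq] at this ⊢
    linarith
  have key := Complex.HadamardThreeLines.norm_le_interp_of_mem_verticalClosedStrip' (f := φ) (l := 1 / 2 + δ) (u := 2)
    (z := s) (a := E * B * 2 * L) (b := E * G) (by linarith) ⟨by linarith, h2⟩ hdiff
    (by
      refine ⟨E * B * 2 * L, ?_⟩
      rintro _ ⟨z, hz, rfl⟩
      exact hA z hz.1 hz.2)
    (by
      intro z hz
      have hz : z.re = 1 / 2 + δ := hz
      exact hA z hz.ge (by linarith))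
    (by
      intro z hz
      have hz : z.re = 2 := hz
      rw [hφ]; simp only
      rw [norm_mul, hexp, mul_comm E G]
      refine mul_le_mul (hG z hz) ?_ (Real.exp_pos _).le (by linarith)
      apply Real.exp_le_exp.mpr
      rw [hz]; nlinarith [sq_nonneg (z.im - s.im)])
  have hlow : ‖deriv Fz s / Fz s‖ ≤ ‖φ s‖ := by
    rw [hφ]; simp only
    rw [norm_mul, hexp]
    apply le_mul_of_one_le_right (norm_nonneg _)
    apply Real.one_le_exp
    rw [sub_self]; nlinarith
  refine (hlow.trans key).trans ?_
  have hBL : 1 ≤ E * B * 2 * L := by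
    have : 1 ≤ E * B := by nlinarith
    nlinarith
  have hEG : 1 ≤ E * G := by nlinarith
  have hd0 : δ / (3 / 2 - δ) ≤ (s.re - (1 / 2 + δ)) / (2 - (1 / 2 + δ)) := by
    have : (2 - (1 / 2 + δ)) = 3 / 2 - δ := by ring
    rw [this]
    gcongr <;> linarith
  have hd1 : (s.re - (1 / 2 + δ)) / (2 - (1 / 2 + δ)) ≤ 1 := by
    rw [div_le_one (by linarith)]; linarith
  calc _ ≤ (E * B * 2 * L) ^ (1 - δ / (3 / 2 - δ)) * (E * G) ^ (1:ℝ) := by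
        refine mul_le_mul ?_ ?_ (by positivity) (by positivity)
        · exact Real.rpow_le_rpow_of_exponent_le hBL (by linarith)
        · exact Real.rpow_le_rpow_of_exponent_le hEG hd1
    _ = _ := by
        rw [Real.rpow_one, Real.mul_rpow (by positivity) (by positivity)]; ring

lemma young (c θ ε : ℝ) (hc : 0 < c) (hθ : 0 < θ) (hθ1 : θ < 1) (hε : 0 < ε) :
    ∃ D : ℝ, ∀ x : ℝ, 1 ≤ x → c * x ^ (1 - θ) ≤ D + ε * x := by
  set x0 := (c / ε) ^ (1 / θ) with hx0
  have hx0p : 0 < x0 := by positivity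
  refine ⟨c * x0 ^ (1 - θ), fun x hx => ?_⟩
  have hxp : 0 < x := by linarith
  rcases le_total x x0 with h | h
  · have : c * x ^ (1 - θ) ≤ c * x0 ^ (1 - θ) := by
      apply mul_le_mul_of_nonneg_left _ hc.le
      exact Real.rpow_le_rpow hxp.le h (by linarith)
    nlinarith
  · have h1 : c / ε ≤ x ^ θ := by
      have : x0 ^ θ ≤ x ^ θ := Real.rpow_le_rpow hx0p.le h hθ.le
      rwa [hx0, ← Real.rpow_mul (by positivity), one_div_mul_cancel hθ.ne', Real.rpow_one] at this
    have h2 : c * x ^ (1 - θ) ≤ ε * x := by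
      rw [Real.rpow_sub hxp, Real.rpow_one, mul_div_assoc', div_le_iff₀ (by positivity)]
      rw [div_le_iff₀ hε] at h1
      nlinarith
    have : 0 < c * x0 ^ (1 - θ) := by positivity
    linarith

lemma inv_bd (hne : ∀ s : ℂ, 1 / 2 < s.re → Fz s ≠ 0) (δ : ℝ) (hδ : 0 < δ) (hδ1 : δ < 1 / 2) (ε : ℝ) (hε : 0 < ε) :
    ∃ C : ℝ, 0 < C ∧ ∀ s : ℂ, 1 / 2 + 2 * δ ≤ s.re → s.re ≤ 2 →
      ‖(s - 1) / Fz s‖ ≤ C * (|s.im| + 10) ^ ε := by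
  obtain ⟨K, θ, hK, hθ, hθ1, hg⟩ := g_pow hne δ hδ hδ1
  obtain ⟨Z, hZ1, hZ⟩ := exists_Z
  obtain ⟨D, hD⟩ := young (K * (3 / 2)) θ ε (by positivity) hθ hθ1 hε
  refine ⟨Z * Real.exp D, by positivity, fun s h1 h2 => ?_⟩
  set c : ℂ := ⟨2, s.im⟩ with hc
  set L := Real.log (|s.im| + 10) with hL
  have hL1 : 1 ≤ L := log_ge_one _
  have hball : ∀ z ∈ Metric.ball c (3 / 2), 1 / 2 < z.re := by
    intro z hz
    rw [mem_ball_iff_norm] at hz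
    have := (abs_le.mp ((Complex.abs_re_le_norm (z - c)))).1
    simp [hc] at this
    linarith
  obtain ⟨f, hf0, hf⟩ := locallog Fz c (3 / 2) (by norm_num)
    (fun z hz => (Fz_diff z (by linarith [hball z hz])).differentiableWithinAt)
    (fun z hz => hne z (hball z hz))
  have hsc : s - c = ((s.re - 2 : ℝ) : ℂ) := by apply Complex.ext <;> simp [hc]
  have hscn : ‖s - c‖ = 2 - s.re := by
    rw [hsc, Complex.norm_real, Real.norm_eq_abs, abs_of_nonpos (by linarith)]; ring
  have hsb : s ∈ Metric.ball c (3 / 2) := by rw [mem_ball_iff_norm, hscn]; linarith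
  -- mean value on the segment
  have hseg : ∀ z ∈ segment ℝ c s, z ∈ Metric.ball c (3 / 2) ∧ z.im = s.im ∧ s.re ≤ z.re ∧ z.re ≤ 2 := by
    intro z hz
    refine ⟨(convex_ball c (3 / 2)).segment_subset (Metric.mem_ball_self (by norm_num)) hsb hz, ?_⟩
    obtain ⟨a, b, ha, hb, hab, rfl⟩ := hz
    have : a = 1 - b := by linarith
    subst this
    refine ⟨?_, ?_, ?_⟩
    · simp [hc]; ring
    · simp [hc]; nlinarith
    · simp [hc]; nlinarith
  have hmv := (convex_segment c s).norm_image_sub_le_of_norm_hasDerivWithin_le (f := f) (𝕜 := ℂ)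
    (f' := fun z => deriv Fz z / Fz z) (C := K * L ^ (1 - θ)) (x := c) (y := s)
    (fun z hz => (hf z (hseg z hz).1).1.hasDerivWithinAt)
    (fun z hz => by
      obtain ⟨_, e1, e2, e3⟩ := hseg z hz
      have := hg z (by linarith) e3
      rwa [e1] at this)
    (left_mem_segment _ _ _) (right_mem_segment _ _ _)
  rw [hf0, sub_zero, hscn] at hmv
  have hfs : ‖f s‖ ≤ D + ε * L := by
    refine (hmv.trans ?_).trans (hD L hL1)
    have : 0 ≤ L ^ (1 - θ) := by positivity
    calc K * L ^ (1 - θ) * (2 - s.re) ≤ K * L ^ (1 - θ) * (3 / 2) := by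
          apply mul_le_mul_of_nonneg_left _ (by positivity); linarith
      _ = _ := by ring
  have hs1 : ‖s - 1‖ ≤ ‖c - 1‖ := by
    rw [← sq_le_sq₀ (norm_nonneg _) (norm_nonneg _), Complex.sq_norm, Complex.sq_norm,
      Complex.normSq_apply, Complex.normSq_apply]
    simp only [hc, Complex.sub_re, Complex.sub_im, Complex.one_re, Complex.one_im]
    nlinarith
  have hcp : 0 < ‖c - 1‖ := by
    rw [norm_pos_iff]
    intro h
    have := congrArg Complex.re h
    simp [hc] at this
    norm_num at this
  have hinv := Fz_inv_two Z hZ s.im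
  rw [(hf s hsb).2, div_eq_mul_inv, mul_inv, norm_mul, norm_mul, ← Complex.exp_neg, Complex.norm_exp]
  have hre : (-f s).re ≤ D + ε * L := by
    refine le_trans ?_ hfs
    rw [← norm_neg]; exact Complex.re_le_norm _
  have hexp : Real.exp (-f s).re ≤ Real.exp D * (|s.im| + 10) ^ ε := by
    rw [Real.rpow_def_of_pos (by positivity), ← Real.exp_add]
    apply Real.exp_le_exp.mpr
    rw [mul_comm (Real.log _)]; exact hre
  calc ‖s - 1‖ * (‖(Fz c)⁻¹‖ * Real.exp (-f s).re) 
      ≤ ‖c - 1‖ * ((Z * ‖c - 1‖⁻¹) * (Real.exp D * (|s.im| + 10) ^ ε)) := by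
        gcongr
    _ = _ := by field_simp

end FranelAux

namespace FranelAux
open MeasureTheory

noncomputable def wfun (x : ℝ) : ℂ := (Set.Ioc 0 1).indicator (fun _ => (1:ℂ)) x - (Set.Ioc 0 1).indicator (fun t : ℝ => (t:ℂ) ^ (1:ℂ)) x

lemma wfun_mellin (s : ℂ) (hs : 0 < s.re) : HasMellin wfun s (1 / (s * (s + 1))) := by
  have h1 := hasMellin_one_Ioc hs
  have h2 := hasMellin_cpow_Ioc 1 (s := s) (by simp; linarith)
  have h3 := hasMellin_sub h1.1 h2.1
  rw [h1.2, h2.2] at h3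
  refine ⟨h3.1, h3.2.trans ?_⟩
  have e1 : s ≠ 0 := by rintro rfl; simp at hs
  have e2 : s + 1 ≠ 0 := by intro h; have := congrArg Complex.re h; simp at this; linarith
  field_simp
  ring

lemma wfun_eq (x : ℝ) (hx : 0 < x) : wfun x = ((max (1 - x) 0 : ℝ) : ℂ) := by
  unfold wfun
  by_cases h : x ≤ 1
  · have hm : x ∈ Set.Ioc (0:ℝ) 1 := ⟨hx, h⟩
    simp only [Set.indicator_of_mem hm]
    rw [max_eq_left (by linarith)]; push_cast; simp
  · have hm : x ∉ Set.Ioc (0:ℝ) 1 := fun h' => h h'.2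
    simp only [Set.indicator_of_notMem hm]
    rw [max_eq_right (by linarith)]; simp

lemma wfun_cont (x : ℝ) (hx : 0 < x) : ContinuousAt wfun x := by
  have : (fun x : ℝ => ((max (1 - x) 0 : ℝ) : ℂ)) =ᶠ[nhds x] wfun := by
    filter_upwards [lt_mem_nhds hx] with y hy using (wfun_eq y hy).symm
  refine ContinuousAt.congr ?_ this
  fun_prop

noncomputable def v2 (t : ℝ) : ℂ := ((2:ℝ) : ℂ) + t * Complex.I

lemma v2_re (t : ℝ) : (v2 t).re = 2 := by simp [v2]
lemma v2_im (t : ℝ) : (v2 t).im = t := by simp [v2]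

lemma v2_ne (t : ℝ) : v2 t ≠ 0 ∧ v2 t + 1 ≠ 0 := by
  constructor
  · intro h; have := congrArg Complex.re h; simp [v2_re] at this
  · intro h; have := congrArg Complex.re h; simp [v2_re] at this; norm_num at this

lemma v2_cont : Continuous v2 := by unfold v2; fun_prop

lemma ker_int : Integrable (fun t : ℝ => 1 / (v2 t * (v2 t + 1))) := by
  refine Integrable.mono' integrable_inv_one_add_sq ?_ ?_
  · apply Continuous.aestronglyMeasurable
    have := v2_cont
    exact continuous_const.div (by fun_prop) fun t => mul_ne_zero (v2_ne t).1 (v2_ne t).2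
  · refine Eventually.of_forall fun t => ?_
    rw [norm_div, norm_one, norm_mul, one_div]
    apply inv_anti₀ (by positivity)
    have h1 : 1 + t ^ 2 ≤ ‖v2 t‖ ^ 2 := by
      rw [Complex.sq_norm, Complex.normSq_apply, v2_re, v2_im]; nlinarith
    have h2 : ‖v2 t‖ ^ 2 ≤ ‖v2 t + 1‖ ^ 2 := by
      rw [Complex.sq_norm, Complex.normSq_apply, Complex.sq_norm, Complex.normSq_apply]
      simp [v2_re, v2_im]; nlinarith
    have h3 : ‖v2 t‖ ≤ ‖v2 t + 1‖ := (sq_le_sq₀ (norm_nonneg _) (norm_nonneg _)).mp h2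
    nlinarith [norm_nonneg (v2 t)]

lemma perron1 (x : ℝ) (hx : 0 < x) :
    ((max (1 - x) 0 : ℝ) : ℂ) = (1 / (2 * Real.pi)) • ∫ t : ℝ, (x : ℂ) ^ (-(v2 t)) * (1 / (v2 t * (v2 t + 1))) := by
  have hm : ∀ t : ℝ, mellin wfun (v2 t) = 1 / (v2 t * (v2 t + 1)) := fun t =>
    (wfun_mellin (v2 t) (by rw [v2_re]; norm_num)).2
  have h := mellinInv_mellin_eq 2 wfun hx (wfun_mellin _ (by simp)).1 (by
    have := ker_int
    simp_rw [← hm] at this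
    exact this) (wfun_cont x hx)
  rw [wfun_eq x hx] at h
  rw [← h]
  unfold mellinInv
  congr 1
  apply integral_congr_ae
  refine Eventually.of_forall fun t => ?_
  have := hm t
  simp only [v2] at this ⊢
  simp only [smul_eq_mul]
  rw [this]

lemma perron2 (N : ℕ) (hN : 1 ≤ N) (n : ℕ) (hn : 1 ≤ n) :
    ((max ((N : ℝ) - n) 0 : ℝ) : ℂ) = (1 / (2 * Real.pi)) • ∫ t : ℝ, (N : ℂ) ^ (v2 t + 1) / (n : ℂ) ^ (v2 t) * (1 / (v2 t * (v2 t + 1))) := by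
  have hN0 : (0:ℝ) < N := by exact_mod_cast hN
  have hn0 : (0:ℝ) < n := by exact_mod_cast hn
  have h := perron1 ((n : ℝ) / N) (by positivity)
  have e : ((max ((N : ℝ) - n) 0 : ℝ) : ℂ) = (N : ℂ) * ((max (1 - (n : ℝ) / N) 0 : ℝ) : ℂ) := by
    have : max ((N : ℝ) - n) 0 = N * max (1 - (n : ℝ) / N) 0 := by
      rw [mul_max_of_nonneg _ _ hN0.le]; congr 1
      · field_simp
      · simp
    rw [this]; push_cast; rfl
  rw [e, h, mul_smul_comm, ← integral_const_mul]
  congr 2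
  funext t
  have hNc : (N : ℂ) ≠ 0 := by exact_mod_cast hN0.ne'
  have hnc : (n : ℂ) ≠ 0 := by exact_mod_cast hn0.ne'
  have e1 : (((n : ℝ) / N : ℝ) : ℂ) ^ (-(v2 t)) = (N : ℂ) ^ (v2 t) / (n : ℂ) ^ (v2 t) := by
    rw [Complex.ofReal_div, div_eq_mul_inv, ← Complex.ofReal_inv, Complex.mul_cpow_ofReal_nonneg hn0.le (by positivity),
      Complex.ofReal_inv, Complex.inv_cpow _ _ (by
        rw [Complex.arg_ofReal_of_nonneg hN0.le]; exact Real.pi_pos.ne), Complex.cpow_neg, Complex.cpow_neg, inv_inv]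
    push_cast
    rw [div_eq_mul_inv, mul_comm]
  rw [e1, Complex.cpow_add _ _ hNc, Complex.cpow_one]
  ring

noncomputable def muC (n : ℕ) : ℂ := ((ArithmeticFunction.moebius n : ℤ) : ℂ)

lemma perron3 (N : ℕ) (hN : 1 ≤ N) :
    HasSum (fun n : ℕ => muC n * ((max ((N : ℝ) - n) 0 : ℝ) : ℂ))
      ((1 / (2 * Real.pi)) • ∫ t : ℝ, (N : ℂ) ^ (v2 t + 1) * (1 / (v2 t * (v2 t + 1))) * LSeries muC (v2 t)) ∧
    Integrable (fun t : ℝ => (N : ℂ) ^ (v2 t + 1) * (1 / (v2 t * (v2 t + 1))) * LSeries muC (v2 t)) := by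
  have hN0 : (0:ℝ) < N := by exact_mod_cast hN
  have hNc : (N : ℂ) ≠ 0 := by exact_mod_cast hN0.ne'
  have hsum : LSeriesSummable muC ((2:ℝ) : ℂ) := ArithmeticFunction.LSeriesSummable_moebius_iff.mpr (by simp)
  set F : ℕ → ℝ → ℂ := fun n t => (N : ℂ) ^ (v2 t + 1) * (1 / (v2 t * (v2 t + 1))) * LSeries.term muC (v2 t) n with hF
  have hnorm : ∀ n t, ‖F n t‖ = ‖LSeries.term muC ((2:ℝ) : ℂ) n‖ * ((N : ℝ) ^ (3:ℝ) * ‖1 / (v2 t * (v2 t + 1))‖) := by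
    intro n t
    rw [hF]; simp only
    rw [norm_mul, norm_mul, LSeries.norm_term_eq, LSeries.norm_term_eq, v2_re, Complex.ofReal_re]
    have : ‖(N : ℂ) ^ (v2 t + 1)‖ = (N : ℝ) ^ (3:ℝ) := by
      rw [show (N : ℂ) = ((N : ℝ) : ℂ) by push_cast; rfl, Complex.norm_cpow_eq_rpow_re_of_pos hN0]
      congr 1
      simp [v2_re]; norm_num
    rw [this]; ring
  have hcont : ∀ n, Continuous (F n) := by
    intro n
    have := v2_cont
    refine Continuous.mul (Continuous.mul ?_ ?_) ?_
    · exact Continuous.const_cpow (by fun_prop) (Or.inl hNc)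
    · exact continuous_const.div (by fun_prop) fun t => mul_ne_zero (v2_ne t).1 (v2_ne t).2
    · by_cases hn : n = 0
      · subst hn; simp only [LSeries.term_zero]; exact continuous_const
      · have hn' : (n : ℂ) ≠ 0 := by exact_mod_cast hn
        simp only [LSeries.term_of_ne_zero hn]
        refine continuous_const.div (Continuous.const_cpow this (Or.inl hn')) fun t => ?_
        rw [Ne, Complex.cpow_eq_zero_iff]; tauto
  have hint : ∀ n, Integrable (F n) := by
    intro n
    refine Integrable.mono' (ker_int.norm.const_mul (‖LSeries.term muC ((2:ℝ) : ℂ) n‖ * (N : ℝ) ^ (3:ℝ))) (hcont n).aestronglyMeasurable ?_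
    refine Eventually.of_forall fun t => ?_
    rw [hnorm]; apply le_of_eq; ring
  have hs2 : Summable fun n => ∫ t, ‖F n t‖ := by
    simp_rw [hnorm, integral_const_mul]
    exact hsum.norm.mul_right _
  have key := hasSum_integral_of_summable_integral_norm hint hs2
  have hts : ∀ t, ∑' n, F n t = (N : ℂ) ^ (v2 t + 1) * (1 / (v2 t * (v2 t + 1))) * LSeries muC (v2 t) := by
    intro t
    rw [hF]; simp only
    rw [tsum_mul_left]; rfl
  simp_rw [hts] at key
  constructor
  · have k2 := key.const_smul (1 / (2 * Real.pi))
    have hfe : (fun n : ℕ => muC n * ((max ((N : ℝ) - n) 0 : ℝ) : ℂ)) = fun i => (1 / (2 * Real.pi)) • ∫ a : ℝ, F i a := by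
     funext n
     by_cases hn : n = 0
     · subst hn; simp [hF, muC]
     · rw [perron2 N hN n (Nat.one_le_iff_ne_zero.mpr hn), mul_smul_comm, ← integral_const_mul]
       congr 2
       funext t
       simp only [hF, LSeries.term_of_ne_zero hn]
       ring
    rw [hfe]; exact k2
  · have hmeas : AEStronglyMeasurable (fun t : ℝ => ∑' n, F n t) volume := by
      have hS : ∀ t, Summable fun n => F n t := fun t => by
        apply Summable.of_norm
        simp_rw [hnorm]
        exact hsum.norm.mul_right _
      exact aestronglyMeasurable_of_tendsto_ae atTop (f := fun k t => ∑ n ∈ Finset.range k, F n t)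
        (fun k => (continuous_finsetSum _ fun n _ => hcont n).aestronglyMeasurable)
        (Eventually.of_forall fun t => (hS t).hasSum.tendsto_sum_nat)
    simp_rw [hts] at hmeas
    refine Integrable.mono' (ker_int.norm.const_mul ((∑' n, ‖LSeries.term muC ((2:ℝ) : ℂ) n‖) * (N : ℝ) ^ (3:ℝ))) hmeas ?_
    refine Eventually.of_forall fun t => ?_
    rw [norm_mul, norm_mul]
    have : ‖(N : ℂ) ^ (v2 t + 1)‖ = (N : ℝ) ^ (3:ℝ) := by
      rw [show (N : ℂ) = ((N : ℝ) : ℂ) by push_cast; rfl, Complex.norm_cpow_eq_rpow_re_of_pos hN0]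
      congr 1
      simp [v2_re]; norm_num
    rw [this]
    have := LS_bd muC (v2 t) 2 (v2_re t) hsum
    calc _ ≤ (N : ℝ) ^ (3:ℝ) * ‖1 / (v2 t * (v2 t + 1))‖ * _ := mul_le_mul_of_nonneg_left this (by positivity)
      _ = _ := by ring

noncomputable def Phi (N : ℕ) (s : ℂ) : ℂ :=
  (((N + 1 : ℕ) : ℂ) ^ (s + 1) - (N : ℂ) ^ (s + 1)) / (s * (s + 1)) * ((s - 1) / Fz s)

lemma perron4 (N : ℕ) (hN : 1 ≤ N) :
    (mert N : ℂ) = (1 / (2 * Real.pi)) • ∫ t : ℝ, Phi N (v2 t) := by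
  obtain ⟨h1, i1⟩ := perron3 (N + 1) (by omega)
  obtain ⟨h2, i2⟩ := perron3 N hN
  have h3 := h1.sub h2
  rw [← smul_sub, ← integral_sub i1 i2] at h3
  have e : (mert N : ℂ) = ∑' n, (muC n * ((max (((N + 1 : ℕ) : ℝ) - n) 0 : ℝ) : ℂ) - muC n * ((max ((N : ℝ) - n) 0 : ℝ) : ℂ)) := by
    rw [tsum_eq_sum (s := Finset.Icc 1 N)]
    · unfold mert
      push_cast
      apply Finset.sum_congr rfl
      intro n hn
      rw [Finset.mem_Icc] at hn
      have : (n : ℝ) ≤ N := by exact_mod_cast hn.2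
      rw [max_eq_left (by linarith), max_eq_left (by linarith)]
      push_cast
      unfold muC
      ring
    · intro n hn
      rw [Finset.mem_Icc, not_and_or] at hn
      rcases hn with hn | hn
      · have : n = 0 := by omega
        subst this; simp [muC]
      · have : (N : ℝ) + 1 ≤ n := by exact_mod_cast (by omega : N + 1 ≤ n)
        rw [max_eq_right (by push_cast; linarith), max_eq_right (by linarith)]
        simp
  rw [e, h3.tsum_eq]
  congr 2
  funext t
  unfold Phi
  have h1 : 1 < (v2 t).re := by rw [v2_re]; norm_num
  have hs1 : v2 t - 1 ≠ 0 := by intro h; have := congrArg Complex.re h; simp [v2_re] at this; norm_num at this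
  have h := ArithmeticFunction.LSeries_zeta_mul_Lseries_moebius h1
  rw [ArithmeticFunction.LSeries_zeta_eq_riemannZeta h1] at h
  have hz := riemannZeta_ne_zero_of_one_le_re h1.le
  have hL : LSeries muC (v2 t) = (riemannZeta (v2 t))⁻¹ := (inv_eq_of_mul_eq_one_right h).symm
  have hq : (v2 t - 1) / Fz (v2 t) = (riemannZeta (v2 t))⁻¹ := by
    rw [Fz_eq_of_one_lt _ h1]; field_simp
  rw [hL, hq]
  ring

end FranelAux

namespace FranelAux
open MeasureTheory

lemma shift (Φ : ℂ → ℂ) (a b C p : ℝ) (hab : a < b) (hp : 1 < p)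
    (hd : ∀ s : ℂ, a ≤ s.re → DifferentiableAt ℂ Φ s)
    (hb : ∀ s : ℂ, a ≤ s.re → s.re ≤ b → ‖Φ s‖ ≤ C * (1 + |s.im|) ^ (-p)) :
    ∫ t : ℝ, Φ ((a : ℂ) + t * Complex.I) = ∫ t : ℝ, Φ ((b : ℂ) + t * Complex.I) := by
  have hint : ∀ x : ℝ, a ≤ x → x ≤ b → Integrable (fun t : ℝ => Φ ((x : ℂ) + t * Complex.I)) := by
    intro x hx hx2
    have h1 : Integrable (fun t : ℝ => C * (1 + ‖t‖) ^ (-p)) :=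
      (integrable_one_add_norm (by simpa using hp)).const_mul C
    refine Integrable.mono' h1 ?_ (Eventually.of_forall fun t => ?_)
    · apply Continuous.aestronglyMeasurable
      rw [continuous_iff_continuousAt]
      intro t
      have := (hd ((x : ℂ) + t * Complex.I) (by simpa using hx)).continuousAt
      exact ContinuousAt.comp (f := fun t : ℝ => (x : ℂ) + t * Complex.I) this (by fun_prop)
    · have := hb ((x : ℂ) + t * Complex.I) (by simpa using hx) (by simpa using hx2)
      simpa using this
  have hrect : ∀ T : ℝ, Complex.I • (∫ y in (-T)..T, Φ ((a : ℂ) + y * Complex.I)) =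
      Complex.I • (∫ y in (-T)..T, Φ ((b : ℂ) + y * Complex.I)) +
      ((∫ x in a..b, Φ (x + ((-T : ℝ) : ℂ) * Complex.I)) - ∫ x in a..b, Φ (x + (T : ℂ) * Complex.I)) := by
    intro T
    have := Complex.integral_boundary_rect_eq_zero_of_differentiableOn Φ ⟨a, -T⟩ ⟨b, T⟩ (by
      intro z hz
      have hz1 := hz.1
      simp only [Set.mem_preimage, Set.uIcc_of_le hab.le] at hz1
      exact (hd z hz1.1).differentiableWithinAt)
    simp only at this
    linear_combination -this
  have hzero : ∀ u : ℝ → ℝ, (∀ T, |u T| = |T|) → Tendsto (fun T : ℝ => ∫ x in a..b, Φ (x + (u T : ℂ) * Complex.I)) atTop (nhds 0) := by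
    intro u hu
    rw [tendsto_zero_iff_norm_tendsto_zero]
    have hlim : Tendsto (fun T : ℝ => C * (1 + T) ^ (-p) * |b - a|) atTop (nhds 0) := by
      have h1 : Tendsto (fun T : ℝ => (1 + T) ^ (-p)) atTop (nhds 0) :=
        (tendsto_rpow_neg_atTop (by linarith)).comp (tendsto_atTop_add_const_left _ _ tendsto_id)
      simpa using (h1.const_mul C).mul_const |b - a|
    refine squeeze_zero' (Eventually.of_forall fun T => norm_nonneg _) ?_ hlim
    filter_upwards [eventually_ge_atTop 0] with T hT
    apply intervalIntegral.norm_integral_le_of_norm_le_const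
    intro x hx
    rw [Set.uIoc_of_le hab.le] at hx
    have := hb (x + (u T : ℂ) * Complex.I) (by simpa using hx.1.le) (by simpa using hx.2)
    simp only [Complex.add_im, Complex.ofReal_im, Complex.mul_im, Complex.ofReal_re, Complex.I_im, mul_one,
      Complex.I_re, mul_zero, add_zero, zero_add] at this
    rwa [hu, abs_of_nonneg hT] at this
  have hA := (intervalIntegral_tendsto_integral (hint a le_rfl hab.le) tendsto_neg_atTop_atBot tendsto_id).const_smul Complex.I
  have hB := (intervalIntegral_tendsto_integral (hint b hab.le le_rfl) tendsto_neg_atTop_atBot tendsto_id).const_smul Complex.I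
  have hC := hB.add ((hzero (fun T => -T) (fun T => abs_neg T)).sub (hzero (fun T => T) (fun T => rfl)))
  simp only [id] at hA hC
  simp_rw [hrect] at hA
  have := tendsto_nhds_unique hA hC
  simpa using this

lemma diff_bd (N : ℕ) (hN : 1 ≤ N) (s : ℂ) (hs : 0 ≤ s.re) (θ : ℝ) (hθ : 0 < θ) (hθ1 : θ < 1) :
    ‖(((N + 1 : ℕ) : ℂ) ^ (s + 1) - (N : ℂ) ^ (s + 1))‖ ≤ 2 * ‖s + 1‖ ^ (1 - θ) * ((N : ℝ) + 1) ^ (s.re + θ) := by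
  have hN0 : (0:ℝ) < N := by exact_mod_cast hN
  have hs1 : s + 1 ≠ 0 := by intro h; have := congrArg Complex.re h; simp at this; linarith
  set X := ‖(((N + 1 : ℕ) : ℂ) ^ (s + 1) - (N : ℂ) ^ (s + 1))‖ with hX
  have hX0 : 0 ≤ X := norm_nonneg _
  have h1 : X ≤ ‖s + 1‖ * ((N : ℝ) + 1) ^ s.re := by
    have := (convex_Icc (N : ℝ) (N + 1)).norm_image_sub_le_of_norm_hasDerivWithin_le (𝕜 := ℝ)
      (f := fun y : ℝ => (y : ℂ) ^ (s + 1)) (f' := fun x : ℝ => (s + 1) * (x : ℂ) ^ (s + 1 - 1))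
      (C := ‖s + 1‖ * ((N : ℝ) + 1) ^ s.re) (x := N) (y := N + 1)
      (fun x hx => (hasDerivAt_ofReal_cpow_const (by have := hx.1; linarith) hs1).hasDerivWithinAt)
      (fun x hx => by
        have hx0 : 0 < x := by have := hx.1; linarith
        rw [norm_mul, Complex.norm_cpow_eq_rpow_re_of_pos hx0, add_sub_cancel_right]
        exact mul_le_mul_of_nonneg_left (Real.rpow_le_rpow hx0.le hx.2 hs) (norm_nonneg _))
      ⟨le_rfl, by linarith⟩ ⟨by linarith, le_rfl⟩
    simpa [hX] using this
  have h2 : X ≤ 2 * ((N : ℝ) + 1) ^ (s.re + 1) := by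
    refine (norm_sub_le _ _).trans ?_
    have e1 : ‖((N + 1 : ℕ) : ℂ) ^ (s + 1)‖ = ((N : ℝ) + 1) ^ (s.re + 1) := by
      rw [show ((N + 1 : ℕ) : ℂ) = ((N + 1 : ℝ) : ℂ) by push_cast; rfl, Complex.norm_cpow_eq_rpow_re_of_pos (by linarith)]
      simp
    have e2 : ‖(N : ℂ) ^ (s + 1)‖ = (N : ℝ) ^ (s.re + 1) := by
      rw [show (N : ℂ) = ((N : ℝ) : ℂ) by push_cast; rfl, Complex.norm_cpow_eq_rpow_re_of_pos hN0]
      simp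
    have e3 : (N : ℝ) ^ (s.re + 1) ≤ ((N : ℝ) + 1) ^ (s.re + 1) :=
      Real.rpow_le_rpow hN0.le (by linarith) (by linarith)
    rw [e1, e2]; linarith
  have hN1 : (0:ℝ) < (N : ℝ) + 1 := by linarith
  calc X = X ^ (1 - θ) * X ^ θ := by
        rw [← Real.rpow_add_of_nonneg hX0 (by linarith) hθ.le]; simp
    _ ≤ (‖s + 1‖ * ((N : ℝ) + 1) ^ s.re) ^ (1 - θ) * (2 * ((N : ℝ) + 1) ^ (s.re + 1)) ^ θ := by
        refine mul_le_mul (Real.rpow_le_rpow hX0 h1 (by linarith)) (Real.rpow_le_rpow hX0 h2 hθ.le) (by positivity) (by positivity)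
    _ = 2 ^ θ * (‖s + 1‖ ^ (1 - θ) * ((N : ℝ) + 1) ^ (s.re + θ)) := by
        rw [Real.mul_rpow (norm_nonneg _) (by positivity), Real.mul_rpow (by norm_num) (by positivity),
          ← Real.rpow_mul hN1.le, ← Real.rpow_mul hN1.le]
        have : ((N : ℝ) + 1) ^ (s.re + θ) = ((N : ℝ) + 1) ^ (s.re * (1 - θ)) * ((N : ℝ) + 1) ^ ((s.re + 1) * θ) := by
          rw [← Real.rpow_add hN1]; congr 1; ring
        rw [this]; ring
    _ ≤ 2 * (‖s + 1‖ ^ (1 - θ) * ((N : ℝ) + 1) ^ (s.re + θ)) := by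
        apply mul_le_mul_of_nonneg_right _ (by positivity)
        calc (2:ℝ) ^ θ ≤ 2 ^ (1:ℝ) := Real.rpow_le_rpow_of_exponent_le (by norm_num) hθ1.le
          _ = 2 := Real.rpow_one 2
    _ = _ := by ring

lemma Phi_bd (hne : ∀ s : ℂ, 1 / 2 < s.re → Fz s ≠ 0) (δ : ℝ) (hδ : 0 < δ) (hδ1 : δ < 1 / 2) :
    ∃ C : ℝ, 0 < C ∧ ∀ N : ℕ, 1 ≤ N → ∀ s : ℂ, 1 / 2 + 2 * δ ≤ s.re → s.re ≤ 2 →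
      ‖Phi N s‖ ≤ C * ((N : ℝ) + 1) ^ (s.re + 2 * δ) * (1 + |s.im|) ^ (-(1 + δ)) := by
  obtain ⟨C, hC, hCb⟩ := inv_bd hne δ hδ hδ1 δ hδ
  refine ⟨2 * 3 * 2 ^ (2 * δ) * C * 10 ^ δ, by positivity, fun N hN s h1 h2 => ?_⟩
  have hd := diff_bd N hN s (by linarith) (2 * δ) (by linarith) (by linarith)
  have hi := hCb s h1 h2
  set u := 1 + |s.im| with hu
  have him := abs_nonneg s.im
  have hu0 : 0 < u := by linarith
  have hs1 : u / 2 ≤ ‖s + 1‖ := by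
    have a1 := Complex.abs_im_le_norm (s + 1)
    have a2 := (le_abs_self _).trans (Complex.abs_re_le_norm (s + 1))
    simp at a1 a2
    linarith
  have hs0 : u / 3 ≤ ‖s‖ := by
    have a1 := Complex.abs_im_le_norm s
    have a2 := (le_abs_self _).trans (Complex.abs_re_le_norm s)
    linarith
  have hs1p : 0 < ‖s + 1‖ := by linarith
  have hs0p : 0 < ‖s‖ := by linarith
  have h10 : (|s.im| + 10) ^ δ ≤ 10 ^ δ * u ^ δ := by
    rw [← Real.mul_rpow (by norm_num) hu0.le]
    exact Real.rpow_le_rpow (by linarith) (by linarith) hδ.le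
  set W := ((N : ℝ) + 1) ^ (s.re + 2 * δ) with hW
  have hW0 : 0 < W := by positivity
  unfold Phi
  rw [norm_mul, norm_div, norm_mul]
  have e1 : ‖s + 1‖ ^ (1 - 2 * δ) / ‖s + 1‖ ≤ 2 ^ (2 * δ) * u ^ (-(2 * δ)) := by
    have : ‖s + 1‖ ^ (1 - 2 * δ) / ‖s + 1‖ = ‖s + 1‖ ^ (-(2 * δ)) := by
      rw [sub_eq_add_neg, Real.rpow_add hs1p, Real.rpow_one]; field_simp
    rw [this]
    calc ‖s + 1‖ ^ (-(2 * δ)) ≤ (u / 2) ^ (-(2 * δ)) :=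
          Real.rpow_le_rpow_of_nonpos (by linarith) hs1 (by linarith)
      _ = _ := by
        rw [Real.div_rpow hu0.le (by norm_num), Real.rpow_neg (by norm_num : (0:ℝ) ≤ 2)]
        field_simp
  have e2 : 1 / ‖s‖ ≤ 3 * u ^ (-1 : ℝ) := by
    rw [Real.rpow_neg_one]
    calc 1 / ‖s‖ ≤ 1 / (u / 3) := one_div_le_one_div_of_le (by linarith) hs0
      _ = _ := by field_simp
  calc _ ≤ (2 * ‖s + 1‖ ^ (1 - 2 * δ) * W) / (‖s‖ * ‖s + 1‖) * (C * (10 ^ δ * u ^ δ)) := by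
        refine mul_le_mul ?_ (hi.trans ?_) (norm_nonneg _) (by positivity)
        · gcongr
        · gcongr
    _ = 2 * W * C * 10 ^ δ * u ^ δ * ((‖s + 1‖ ^ (1 - 2 * δ) / ‖s + 1‖) * (1 / ‖s‖)) := by
        field_simp
    _ ≤ 2 * W * C * 10 ^ δ * u ^ δ * ((2 ^ (2 * δ) * u ^ (-(2 * δ))) * (3 * u ^ (-1 : ℝ))) := by
        apply mul_le_mul_of_nonneg_left _ (by positivity)
        exact mul_le_mul e1 e2 (by positivity) (by positivity)
    _ = 2 * 3 * 2 ^ (2 * δ) * C * 10 ^ δ * W * (u ^ δ * u ^ (-(2 * δ)) * u ^ (-1 : ℝ)) := by ring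
    _ = _ := by
        rw [← Real.rpow_add hu0, ← Real.rpow_add hu0]
        congr 2; ring

lemma Phi_diff (hne : ∀ s : ℂ, 1 / 2 < s.re → Fz s ≠ 0) (N : ℕ) (hN : 1 ≤ N) (s : ℂ) (hs : 1 / 2 < s.re) :
    DifferentiableAt ℂ (Phi N) s := by
  have e1 : s ≠ 0 := by rintro rfl; simp at hs; linarith
  have e2 : s + 1 ≠ 0 := by intro h; have := congrArg Complex.re h; simp at this; linarith
  have e3 := hne s hs
  have hF := Fz_diff s (by linarith)
  have hN0 : (N : ℂ) ≠ 0 := by exact_mod_cast (by omega : N ≠ 0)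
  have hN1 : ((N + 1 : ℕ) : ℂ) ≠ 0 := by exact_mod_cast (by omega : N + 1 ≠ 0)
  unfold Phi
  refine DifferentiableAt.mul (DifferentiableAt.div (DifferentiableAt.sub ?_ ?_) (by fun_prop) (mul_ne_zero e1 e2))
    (DifferentiableAt.div (by fun_prop) hF e3)
  · exact DifferentiableAt.const_cpow (by fun_prop) (Or.inl hN1)
  · exact DifferentiableAt.const_cpow (by fun_prop) (Or.inl hN0)

lemma mert_of_ne (hne : ∀ s : ℂ, 1 / 2 < s.re → Fz s ≠ 0) (δ : ℝ) (hδ : 0 < δ) (hδ1 : δ < 1 / 2) :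
    ∃ C : ℝ, 0 < C ∧ ∀ N : ℕ, 1 ≤ N → |mert N| ≤ C * (N : ℝ) ^ (1 / 2 + 4 * δ) := by
  obtain ⟨C, hC, hb⟩ := Phi_bd hne δ hδ hδ1
  set I0 := ∫ t : ℝ, (1 + ‖t‖) ^ (-(1 + δ)) with hI0
  have hint : Integrable (fun t : ℝ => (1 + ‖t‖) ^ (-(1 + δ))) := integrable_one_add_norm (by simpa using hδ)
  have hI0n : 0 ≤ I0 := integral_nonneg fun t => by positivity
  refine ⟨1 / (2 * Real.pi) * (C * 2 ^ (1 / 2 + 4 * δ) * I0) + 1, by positivity, fun N hN => ?_⟩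
  have hN0 : (1:ℝ) ≤ N := by exact_mod_cast hN
  have hsh := shift (Phi N) (1 / 2 + 2 * δ) 2 (C * ((N : ℝ) + 1) ^ (2 + 2 * δ)) (1 + δ)
  have hp := perron4 N hN
  have hv : (∫ t : ℝ, Phi N (v2 t)) = ∫ t : ℝ, Phi N (((1 / 2 + 2 * δ : ℝ) : ℂ) + t * Complex.I) := by
    by_cases hlt : 1 / 2 + 2 * δ < 2
    · symm
      refine shift (Phi N) (1 / 2 + 2 * δ) 2 (C * ((N : ℝ) + 1) ^ (2 + 2 * δ)) (1 + δ) hlt (by linarith)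
        (fun s hs => Phi_diff hne N hN s (by linarith)) (fun s hs1 hs2 => (hb N hN s hs1 hs2).trans ?_)
      gcongr
      linarith
    · linarith
  rw [hv] at hp
  have hn : |mert N| = ‖(mert N : ℂ)‖ := by simp
  rw [hn, hp, norm_smul, Real.norm_eq_abs, abs_of_nonneg (by positivity)]
  have hI : ‖∫ t : ℝ, Phi N (((1 / 2 + 2 * δ : ℝ) : ℂ) + t * Complex.I)‖ ≤
      C * ((N : ℝ) + 1) ^ (1 / 2 + 4 * δ) * I0 := by
    rw [hI0, ← integral_const_mul]
    refine norm_integral_le_of_norm_le (hint.const_mul _) (Eventually.of_forall fun t => ?_)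
    have := hb N hN (((1 / 2 + 2 * δ : ℝ) : ℂ) + t * Complex.I) (by simp) (by simp; linarith)
    have e1 : (((1 / 2 + 2 * δ : ℝ) : ℂ) + t * Complex.I).re = 1 / 2 + 2 * δ := by simp
    have e2 : (((1 / 2 + 2 * δ : ℝ) : ℂ) + t * Complex.I).im = t := by simp
    rw [e1, e2] at this
    rw [Real.norm_eq_abs]
    convert this using 4
    ring
  have h2 : ((N : ℝ) + 1) ^ (1 / 2 + 4 * δ) ≤ 2 ^ (1 / 2 + 4 * δ) * (N : ℝ) ^ (1 / 2 + 4 * δ) := by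
    rw [← Real.mul_rpow (by norm_num) (by linarith)]
    exact Real.rpow_le_rpow (by linarith) (by linarith) (by linarith)
  calc _ ≤ 1 / (2 * Real.pi) * (C * (2 ^ (1 / 2 + 4 * δ) * (N : ℝ) ^ (1 / 2 + 4 * δ)) * I0) := by
        apply mul_le_mul_of_nonneg_left _ (by positivity)
        refine hI.trans ?_
        gcongr
    _ = (1 / (2 * Real.pi) * (C * 2 ^ (1 / 2 + 4 * δ) * I0)) * (N : ℝ) ^ (1 / 2 + 4 * δ) := by ring
    _ ≤ _ := by
        apply mul_le_mul_of_nonneg_right _ (by positivity)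
        linarith

theorem mert_of_RH (H : ∀ s : ℂ, riemannZeta s = 0 → 0 < s.re → s.re < 1 → s.re = 1 / 2) (ε : ℝ) (hε : 0 < ε) :
    ∃ C : ℝ, ∀ m : ℕ, |mert m| ≤ C * (m : ℝ) ^ (1 / 2 + ε) := by
  have hne : ∀ s : ℂ, 1 / 2 < s.re → Fz s ≠ 0 := by
    intro s hs h0
    by_cases h1 : s = 1
    · subst h1; rw [Fz_one] at h0; exact one_ne_zero h0
    · rw [Fz_eq s (by linarith) h1] at h0
      have hz : riemannZeta s = 0 := by
        rcases mul_eq_zero.mp h0 with h | h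
        · exact absurd (sub_eq_zero.mp h) h1
        · exact h
      by_cases h2 : s.re < 1
      · have := H s hz (by linarith) h2
        linarith
      · exact riemannZeta_ne_zero_of_one_le_re (not_lt.mp h2) hz
  set δ := min (ε / 4) (1 / 8) with hδ
  have hδ0 : 0 < δ := lt_min (by linarith) (by norm_num)
  have hδ1 : δ ≤ 1 / 8 := min_le_right _ _
  have hδ2 : δ ≤ ε / 4 := min_le_left _ _
  obtain ⟨C, hC, hb⟩ := mert_of_ne hne δ hδ0 (by linarith)
  refine ⟨C, fun m => ?_⟩
  rcases Nat.eq_zero_or_pos m with rfl | hm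
  · have : mert 0 = 0 := by simp [mert]
    rw [this, abs_zero]; positivity
  · refine (hb m hm).trans (mul_le_mul_of_nonneg_left ?_ hC.le)
    exact Real.rpow_le_rpow_of_exponent_le (by exact_mod_cast hm) (by linarith)

end FranelAux

/-- Franel's theorem: the Riemann Hypothesis holds if and only if for every
`ε > 0` one has `∑_{ν=1}^{A(n)} |f_ν(n) - ν/A(n)| = O(n^{1/2+ε})` as
`n → ∞`, where `f_1(n) < ⋯ < f_{A(n)}(n)` are the reduced fractions in
`(0, 1]` with denominator at most `n`, and `A(n)` is their number. -/
theorem franel_theorem :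
    (∀ s : ℂ, riemannZeta s = 0 → 0 < s.re → s.re < 1 → s.re = 1 / 2) ↔
      ∀ ε : ℝ, 0 < ε →
        (fun n : ℕ => ∑ ν ∈ Finset.range (fareyList n).length,
            |(((fareyList n).getD ν 0 : ℚ) : ℝ) -
              ((ν : ℝ) + 1) / ((fareyList n).length : ℝ)|)
          =O[atTop] fun n : ℕ => (n : ℝ) ^ ((1 : ℝ) / 2 + ε) := by
  constructor
  · intro H ε hε
    obtain ⟨C, hC⟩ := FranelAux.mert_of_RH H ε hε
    obtain ⟨K, hK⟩ := FranelAux.err_bound ε hε C hC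
    refine Asymptotics.IsBigO.of_bound (K + 3 / 2) ?_
    filter_upwards [eventually_ge_atTop 1] with n hn
    have h1 := FranelAux.farey_L1 n hn
    have h2 := hK n hn
    have h3 : (1:ℝ) ≤ (n : ℝ) ^ ((1 : ℝ) / 2 + ε) :=
      Real.one_le_rpow (by exact_mod_cast hn) (by linarith)
    rw [Real.norm_of_nonneg (Finset.sum_nonneg fun _ _ => abs_nonneg _), Real.norm_of_nonneg (by positivity)]
    refine h1.trans ?_
    linarith
  · intro H
    apply FranelAux.RH_of_mert
    intro ε hε
    obtain ⟨C, hC⟩ := (H ε hε).bound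
    obtain ⟨N0, hN0⟩ := eventually_atTop.mp hC
    refine ⟨2 * Real.pi * |C| + (N0 + 2 : ℕ), fun m => ?_⟩
    rcases Nat.eq_zero_or_pos m with rfl | hm
    · have : FranelAux.mert 0 = 0 := by simp [FranelAux.mert]
      rw [this, abs_zero]; positivity
    have h3 : (1:ℝ) ≤ (m : ℝ) ^ ((1 : ℝ) / 2 + ε) :=
      Real.one_le_rpow (by exact_mod_cast hm) (by linarith)
    have hpi := Real.pi_pos
    by_cases hmN : N0 + 2 ≤ m
    · have h1 := FranelAux.farey_exp m (by omega)
      have h2 := hN0 m (by omega)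
      rw [Real.norm_of_nonneg (Finset.sum_nonneg fun _ _ => abs_nonneg _), Real.norm_of_nonneg (by positivity)] at h2
      have h4 : C * (m : ℝ) ^ ((1 : ℝ) / 2 + ε) ≤ |C| * (m : ℝ) ^ ((1 : ℝ) / 2 + ε) :=
        mul_le_mul_of_nonneg_right (le_abs_self C) (by positivity)
      have h5 := mul_le_mul_of_nonneg_left (h2.trans h4) (by positivity : 0 ≤ 2 * Real.pi)
      have h6 : (0:ℝ) ≤ ((N0 + 2 : ℕ) : ℝ) * (m : ℝ) ^ ((1 : ℝ) / 2 + ε) := by positivity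
      nlinarith
    · have h1 := FranelAux.mert_bd m
      have h2 : (m : ℝ) ≤ ((N0 + 2 : ℕ) : ℝ) := by exact_mod_cast (by omega : m ≤ N0 + 2)
      have h6 : (0:ℝ) ≤ 2 * Real.pi * |C| * (m : ℝ) ^ ((1 : ℝ) / 2 + ε) := by positivity
      have h7 : ((N0 + 2 : ℕ) : ℝ) ≤ ((N0 + 2 : ℕ) : ℝ) * (m : ℝ) ^ ((1 : ℝ) / 2 + ε) :=
        le_mul_of_one_le_right (by positivity) h3
      linarith
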